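/- arXiv:1808.07127 — 3 statements merged into one kernel-verified Lean document; each statement's English description precedes it below -/
import Mathlib

section
/- (Theorem 2.1, Type I error) Suppose h(θ*) ∈ Ω (the null hypothesis holds). Fix α₁, α₂ > 0 with α₁ + α₂ = α ∈ (0,1), and define the random threshold r_{α,q} := (σ/R) ∑_{r=1}^R ‖(1/n)XᵀZ_r‖_q + τ_{α₁,q} + (1/√R) τ_{α₂,q}. Then with probability at least 1 − α over (W, Z₁,…,Z_R), every pair (θ̂, μ̂) that is optimal for the program 'minimize μ over (θ,μ) ∈ ℝ^p × ℝ subject to ‖(1/n)∑_{i=1}^n X_i (Y_i − g(V_i,θ))‖_q ≤ r_{α,q} + μ, h(θ) ∈ Ω, μ ≥ 0' satisfies ‖(1/n)∑_{i=1}^n X_i (Y_i − g(V_i,θ̂))‖_q ≤ r_{α,q}; in particular the probability that some optimal θ̂ has ‖(1/n)∑_{i=1}^n X_i (Y_i − g(V_i,θ̂))‖_q > r_{α,q} is at most α. -/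
open MeasureTheory ProbabilityTheory
open scoped ENNReal NNReal

noncomputable def lqNorm (q : ℝ≥0∞) {L : ℕ} (v : Fin L → ℝ) : ℝ :=
  (eLpNorm v q Measure.count).toReal

noncomputable def Nq (q : ℝ≥0∞) {n L : ℕ} (X : Fin n → Fin L → ℝ) : ℝ :=
  lqNorm q (fun j => Real.sqrt ((1 / (n : ℝ)) * ∑ i, (X i j) ^ 2))

noncomputable def gaussianVec (n : ℕ) (σ : ℝ) : Measure (Fin n → ℝ) :=
  Measure.pi (fun _ => gaussianReal 0 ⟨σ ^ 2, sq_nonneg σ⟩)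

/-- Feasibility for the program (p2-1). -/
def FeasibleP2 {n L k p m : ℕ} (X : Fin n → Fin L → ℝ)
    (g : (Fin k → ℝ) → (Fin p → ℝ) → ℝ) (V : Fin n → Fin k → ℝ) (Y : Fin n → ℝ)
    (h : (Fin p → ℝ) → Fin m → ℝ) (Ω : Set (Fin m → ℝ)) (q : ℝ≥0∞) (r : ℝ)
    (θ : Fin p → ℝ) (μ : ℝ) : Prop :=
  lqNorm q (fun j => (1 / (n : ℝ)) * ∑ i, X i j * (Y i - g (V i) θ)) ≤ r + μ ∧
    h θ ∈ Ω ∧ 0 ≤ μ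

/-- Optimality for the program (p2-1). -/
def OptimalP2 {n L k p m : ℕ} (X : Fin n → Fin L → ℝ)
    (g : (Fin k → ℝ) → (Fin p → ℝ) → ℝ) (V : Fin n → Fin k → ℝ) (Y : Fin n → ℝ)
    (h : (Fin p → ℝ) → Fin m → ℝ) (Ω : Set (Fin m → ℝ)) (q : ℝ≥0∞) (r : ℝ)
    (θ : Fin p → ℝ) (μ : ℝ) : Prop :=
  FeasibleP2 X g V Y h Ω q r θ μ ∧
    ∀ θ' μ', FeasibleP2 X g V Y h Ω q r θ' μ' → μ ≤ μ'

/-- The deviation term `τ_{ς,q} = σ N_q(X) √((2/n) log(1/ς))`. -/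
noncomputable def tau {n L : ℕ} (X : Fin n → Fin L → ℝ) (σ : ℝ) (q : ℝ≥0∞) (ς : ℝ) : ℝ :=
  σ * Nq q X * Real.sqrt ((2 / (n : ℝ)) * Real.log (1 / ς))

/-- The data-driven threshold `r_{α,q}` built from the Monte Carlo draws `z`. -/
noncomputable def rThresh {n L R : ℕ} (X : Fin n → Fin L → ℝ) (σ : ℝ) (q : ℝ≥0∞)
    (α₁ α₂ : ℝ) (z : Fin R → Fin n → ℝ) : ℝ :=
  (σ / R) * ∑ r, lqNorm q (fun j => (1 / (n : ℝ)) * ∑ i, X i j * z r i)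
    + tau X σ q α₁ + (1 / Real.sqrt R) * tau X σ q α₂

set_option linter.unusedSectionVars false
section GaussConc

variable {E : Type*} [NormedAddCommGroup E] [InnerProductSpace ℝ E] [FiniteDimensional ℝ E]
  [MeasurableSpace E] [BorelSpace E]

lemma gc_int_exp (B : ℝ) : Integrable (fun x : E => Real.exp (B * ‖x‖)) (stdGaussian E) := by
  obtain ⟨C, hC, hint⟩ := IsGaussian.exists_integrable_exp_sq (stdGaussian E)
  refine (hint.const_mul (Real.exp (B ^ 2 / (4 * C)))).mono' (by fun_prop) ?_
  refine Filter.Eventually.of_forall fun x => ?_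
  rw [Real.norm_eq_abs, Real.abs_exp, ← Real.exp_add]
  apply Real.exp_le_exp.2
  have : B ^ 2 / (4 * C) + C * ‖x‖ ^ 2 - B * ‖x‖ = (B - 2 * C * ‖x‖) ^ 2 / (4 * C) := by
    field_simp; ring
  have h2 : 0 ≤ (B - 2 * C * ‖x‖) ^ 2 / (4 * C) := by positivity
  linarith

lemma gc_int_of_le {f : E → ℝ} (hf : Continuous f) (A B : ℝ)
    (h : ∀ x, |f x| ≤ A * Real.exp (B * ‖x‖)) : Integrable f (stdGaussian E) :=
  ((gc_int_exp B).const_mul A).mono' hf.aestronglyMeasurable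
    (Filter.Eventually.of_forall fun x => by simpa using h x)

lemma gc_lip_bound {F : E → ℝ} {K : ℝ≥0} (hF : LipschitzWith K F) (x v : E) :
    |F (x + v) - F x| ≤ K * ‖v‖ := by
  have := hF.dist_le_mul (x + v) x
  simpa [Real.dist_eq, dist_eq_norm] using this

lemma gc_int_lip {F : E → ℝ} {K : ℝ≥0} (hF : LipschitzWith K F) (x : E) (s : ℝ) :
    Integrable (fun g => F (x + s • g)) (stdGaussian E) := by
  refine gc_int_of_le (hF.continuous.comp (by fun_prop)) (|F x| + K * |s|) 1 fun g => ?_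
  have h1 := gc_lip_bound hF x (s • g)
  have h2 : |F (x + s • g)| ≤ |F x| + |F (x + s • g) - F x| := by
    have := abs_add_le (F x) (F (x + s • g) - F x); simpa using this
  rw [norm_smul, Real.norm_eq_abs] at h1
  have h3 : ‖g‖ ≤ Real.exp (1 * ‖g‖) := by linarith [Real.add_one_le_exp (1 * ‖g‖)]
  have h4 : 1 ≤ Real.exp (1 * ‖g‖) := Real.one_le_exp (by positivity)
  calc |F (x + s • g)| ≤ |F x| * 1 + (K * |s|) * ‖g‖ := by linarith
    _ ≤ |F x| * Real.exp (1 * ‖g‖) + (K * |s|) * Real.exp (1 * ‖g‖) := by gcongr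
    _ = _ := by ring

lemma gc_int_exp_lip {F : E → ℝ} {K : ℝ≥0} (hF : LipschitzWith K F) (x : E) (s : ℝ) :
    Integrable (fun g => Real.exp (F (x + s • g))) (stdGaussian E) := by
  refine gc_int_of_le (Real.continuous_exp.comp (hF.continuous.comp (by fun_prop)))
    (Real.exp (F x)) (K * |s|) fun g => ?_
  have h1 := gc_lip_bound hF x (s • g)
  rw [norm_smul, Real.norm_eq_abs] at h1
  rw [Real.abs_exp, ← Real.exp_add]
  apply Real.exp_le_exp.2
  linarith [le_abs_self (F (x + s • g) - F x)]

lemma gc_conv (a b c : ℝ) (habc : a ^ 2 + b ^ 2 = c ^ 2) :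
    ((stdGaussian E).map (fun x => a • x)) ∗ ((stdGaussian E).map (fun x => b • x))
      = (stdGaussian E).map (fun x => c • x) := by
  have h1 : IsProbabilityMeasure ((stdGaussian E).map (fun x => a • x)) :=
    Measure.isProbabilityMeasure_map (by fun_prop)
  have h2 : IsProbabilityMeasure ((stdGaussian E).map (fun x => b • x)) :=
    Measure.isProbabilityMeasure_map (by fun_prop)
  have h3 : IsProbabilityMeasure ((stdGaussian E).map (fun x => c • x)) :=
    Measure.isProbabilityMeasure_map (by fun_prop)
  apply Measure.ext_of_charFun
  ext t
  rw [charFun_conv, charFun_map_smul, charFun_map_smul, charFun_map_smul, charFun_stdGaussian,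
    charFun_stdGaussian, charFun_stdGaussian, ← Complex.exp_add]
  congr 1
  simp only [norm_smul, Real.norm_eq_abs]
  norm_cast
  simp only [mul_pow, sq_abs]
  rw [← habc]; ring

lemma gc_stable (a b c : ℝ) (habc : a ^ 2 + b ^ 2 = c ^ 2) {f : E → ℝ} (hf : Continuous f)
    (x : E) (hint : Integrable (fun g => f (x + c • g)) (stdGaussian E)) :
    ∫ g, f (x + c • g) ∂(stdGaussian E)
      = ∫ g, ∫ g', f (x + a • g + b • g') ∂(stdGaussian E) ∂(stdGaussian E) := by
  have hf' : Continuous (fun y => f (x + y)) := by fun_prop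
  have e1 : ∫ g, f (x + c • g) ∂(stdGaussian E)
      = ∫ y, f (x + y) ∂((stdGaussian E).map (fun x => c • x)) := by
    rw [integral_map (by fun_prop) hf'.aestronglyMeasurable]
  rw [e1, ← gc_conv a b c habc, integral_conv, integral_map (by fun_prop)]
  · congr 1; ext g
    rw [integral_map (by fun_prop)]
    · simp [add_assoc]
    · exact (hf'.comp (by fun_prop : Continuous fun y => a • g + y)).aestronglyMeasurable
  · refine StronglyMeasurable.aestronglyMeasurable ?_
    refine StronglyMeasurable.integral_prod_right' (f := fun p : E × E => f (x + (p.1 + p.2))) ?_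
    exact (hf'.comp (by fun_prop : Continuous fun p : E × E => p.1 + p.2)).stronglyMeasurable
  · rw [gc_conv a b c habc]
    rw [integrable_map_measure hf'.aestronglyMeasurable (by fun_prop)]
    exact hint

def GCGood (K : ℝ≥0) (C : ℝ) (F : E → ℝ) : Prop :=
  LipschitzWith K F ∧ ∀ x, ∃ A : E →L[ℝ] ℝ, ∀ v, |F (x + v) - F x - A v| ≤ C * ‖v‖ ^ 2

lemma gc_hasFDerivAt {F : E → ℝ} {C : ℝ} {x : E} {A : E →L[ℝ] ℝ}
    (h : ∀ v, |F (x + v) - F x - A v| ≤ C * ‖v‖ ^ 2) : HasFDerivAt F A x := by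
  rw [hasFDerivAt_iff_isLittleO_nhds_zero]
  have h1 : (fun v : E => F (x + v) - F x - A v) =O[nhds 0] fun v => ‖v‖ ^ 2 := by
    refine Asymptotics.IsBigO.of_bound C (Filter.Eventually.of_forall fun v => ?_)
    simpa using h v
  refine h1.trans_isLittleO ?_
  exact Asymptotics.isLittleO_norm_pow_id (by norm_num)

lemma gc_good_avg {F : E → ℝ} {K : ℝ≥0} {C : ℝ} (hF : GCGood K C F) (s : ℝ) :
    GCGood K C (fun x => ∫ g, F (x + s • g) ∂(stdGaussian E)) := by
  obtain ⟨hL, hA⟩ := hF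
  refine ⟨?_, fun x => ?_⟩
  · refine LipschitzWith.of_dist_le_mul fun x y => ?_
    rw [Real.dist_eq, ← integral_sub (gc_int_lip hL x s) (gc_int_lip hL y s)]
    have := norm_integral_le_of_norm_le_const (μ := stdGaussian E)
      (f := fun g => F (x + s • g) - F (y + s • g)) (C := K * dist x y)
      (Filter.Eventually.of_forall fun g => by
        have := hL.dist_le_mul (x + s • g) (y + s • g)
        simpa [Real.dist_eq] using this)
    simpa using this
  · have hd : ∀ y v, |F (y + v) - F y - fderiv ℝ F y v| ≤ C * ‖v‖ ^ 2 := by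
      intro y v
      obtain ⟨A, hA'⟩ := hA y
      rw [(gc_hasFDerivAt hA').fderiv]
      exact hA' v
    have hint : Integrable (fun g => fderiv ℝ F (x + s • g)) (stdGaussian E) := by
      refine Integrable.of_bound (C := K) ?_ (Filter.Eventually.of_forall fun g => ?_)
      · exact ((measurable_fderiv ℝ F).comp (by fun_prop)).aestronglyMeasurable
      · exact norm_fderiv_le_of_lipschitz ℝ hL
    refine ⟨∫ g, fderiv ℝ F (x + s • g) ∂(stdGaussian E), fun v => ?_⟩
    have hi : Integrable (fun g => F (x + v + s • g) - F (x + s • g)) (stdGaussian E) :=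
      (gc_int_lip hL _ s).sub (gc_int_lip hL x s)
    rw [ContinuousLinearMap.integral_apply hint, ← integral_sub (gc_int_lip hL _ s) (gc_int_lip hL x s),
      ← integral_sub hi (hint.apply_continuousLinearMap v)]
    have := norm_integral_le_of_norm_le_const (μ := stdGaussian E)
      (f := fun g => F (x + v + s • g) - F (x + s • g) - fderiv ℝ F (x + s • g) v)
      (C := C * ‖v‖ ^ 2)
      (Filter.Eventually.of_forall fun g => by
        have := hd (x + s • g) v
        rwa [add_right_comm] at this)
    simpa using this

lemma gc_exp_le (y : ℝ) : Real.exp y ≤ 1 + y + y ^ 2 / 2 + |y| ^ 3 * Real.exp |y| := by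
  have h := Complex.norm_exp_sub_sum_le_norm_mul_exp (y : ℂ) 3
  simp only [Finset.sum_range_succ, Finset.sum_range_zero, Nat.factorial] at h
  have e : Complex.exp (y : ℂ) - (0 + (y : ℂ) ^ 0 / ((1 : ℕ) : ℂ) + (y : ℂ) ^ 1 / ((0 + 1) * 1 : ℕ)
    + (y : ℂ) ^ 2 / (((1 + 1) * ((0 + 1) * 1) : ℕ) : ℂ)) =
      ((Real.exp y - (1 + y + y ^ 2 / 2) : ℝ) : ℂ) := by
    push_cast; ring
  rw [e, Complex.norm_real, Complex.norm_real, Real.norm_eq_abs, Real.norm_eq_abs] at h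
  linarith [le_abs_self (Real.exp y - (1 + y + y ^ 2 / 2))]

lemma gc_step (K : ℝ≥0) (C : ℝ) (hC : 0 ≤ C) : ∃ B : ℝ, ∀ s : ℝ, 0 ≤ s → s ≤ 1 →
    ∀ F : E → ℝ, GCGood K C F → ∀ x : E,
    ∫ g, Real.exp (F (x + s • g)) ∂(stdGaussian E)
      ≤ Real.exp (∫ g, F (x + s • g) ∂(stdGaussian E) + (s ^ 2 * K ^ 2 / 2 + s ^ 3 * B)) := by
  set m : ℝ := ∫ g : E, ‖g‖ ∂(stdGaussian E) with hm
  have hm0 : 0 ≤ m := integral_nonneg fun _ => norm_nonneg _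
  have hnint : Integrable (fun g : E => ‖g‖) (stdGaussian E) :=
    IsGaussian.integrable_id.norm
  let U : E → ℝ := fun g => (6 * K * C + 12 * C ^ 2) * Real.exp (1 * ‖g‖)
    + 6 * Real.exp (2 * K * m) * Real.exp (2 * K * ‖g‖)
  have hU : Integrable U (stdGaussian E) :=
    ((gc_int_exp 1).const_mul _).add ((gc_int_exp (2 * K)).const_mul _)
  refine ⟨∫ g, U g ∂(stdGaussian E), fun s hs0 hs1 F hF x => ?_⟩
  obtain ⟨hL, hA⟩ := hF
  obtain ⟨A, hA⟩ := hA x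
  have hAK : ‖A‖ ≤ K := (gc_hasFDerivAt hA).le_of_lipschitz hL
  let D : E → ℝ := fun g => F (x + s • g) - F x
  have hDint : Integrable D (stdGaussian E) := (gc_int_lip hL x s).sub (integrable_const _)
  set e : ℝ := ∫ g, D g ∂(stdGaussian E) with he
  have hDb : ∀ g, |D g| ≤ s * K * ‖g‖ := fun g => by
    have := gc_lip_bound hL x (s • g)
    rw [norm_smul, Real.norm_eq_abs, abs_of_nonneg hs0] at this
    calc _ ≤ _ := this
      _ = _ := by ring
  have heb : |e| ≤ s * K * m := by
    have := norm_integral_le_of_norm_le (μ := stdGaussian E) (f := D) (hnint.const_mul (s * K))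
      (Filter.Eventually.of_forall hDb)
    rwa [integral_const_mul] at this
  have hAvar : ∫ g, (A g) ^ 2 ∂(stdGaussian E) = ‖A‖ ^ 2 := by
    rw [← variance_dual_stdGaussian A, variance_of_integral_eq_zero]
    · exact A.continuous.aemeasurable
    · exact integral_strongDual_stdGaussian A
  have hAint : Integrable (fun g => (A g) ^ 2) (stdGaussian E) :=
    (IsGaussian.memLp_two_id.continuousLinearMap_comp A).integrable_sq
  -- the pointwise bound
  have hpt : ∀ g, Real.exp (D g - e) ≤
      (1 - e + e ^ 2 / 2) + (1 - e) * D g + s ^ 2 / 2 * (A g) ^ 2 + s ^ 3 * U g := by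
    intro g
    have hr := norm_nonneg g
    set r := ‖g‖ with hrdef
    have hY : |D g - e| ≤ s * (K * (r + m)) := by
      calc |D g - e| ≤ |D g| + |e| := abs_sub _ _
        _ ≤ s * K * r + s * K * m := add_le_add (hDb g) heb
        _ = _ := by ring
    set u : ℝ := K * (r + m) with hu
    have hu0 : 0 ≤ u := by positivity
    have hcube : |D g - e| ^ 3 * Real.exp |D g - e| ≤
        s ^ 3 * (6 * Real.exp (2 * K * m) * Real.exp (2 * K * r)) := by
      have h6 : u ^ 3 ≤ 6 * Real.exp u := by
        have := Real.pow_div_factorial_le_exp u hu0 3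
        norm_num [Nat.factorial] at this
        linarith
      have hsu : s * u ≤ u := by nlinarith
      calc |D g - e| ^ 3 * Real.exp |D g - e| ≤ (s * u) ^ 3 * Real.exp u := by
            gcongr; exact hY.trans hsu
        _ = s ^ 3 * (u ^ 3 * Real.exp u) := by ring
        _ ≤ s ^ 3 * (6 * Real.exp u * Real.exp u) := by gcongr
        _ = s ^ 3 * (6 * (Real.exp u * Real.exp u)) := by ring
        _ = s ^ 3 * (6 * (Real.exp (2 * K * m) * Real.exp (2 * K * r))) := by
            rw [← Real.exp_add, ← Real.exp_add, hu]; ring_nf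
        _ = _ := by ring
    have hsq : (D g) ^ 2 ≤ s ^ 2 * (A g) ^ 2 + s ^ 3 * ((12 * K * C + 24 * C ^ 2) * Real.exp (1 * r)) := by
      have h1 := hA (s • g)
      rw [norm_smul, Real.norm_eq_abs, abs_of_nonneg hs0, map_smul, smul_eq_mul] at h1
      have hAg : |A g| ≤ K * r := by
        have := A.le_opNorm g
        rw [Real.norm_eq_abs] at this
        exact this.trans (by gcongr)
      have h2 : |D g| ≤ s * |A g| + C * (s * r) ^ 2 := by
        have : |D g| ≤ |s * A g| + |D g - s * A g| := by
          have := abs_add_le (s * A g) (D g - s * A g); simpa using this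
        rw [abs_mul, abs_of_nonneg hs0] at this
        exact this.trans (by gcongr)
      have h3 : (D g) ^ 2 ≤ (s * |A g| + C * (s * r) ^ 2) ^ 2 := by
        rw [← sq_abs]; gcongr
      have hr3 : r ^ 3 ≤ 6 * Real.exp (1 * r) := by
        have := Real.pow_div_factorial_le_exp r hr 3
        norm_num [Nat.factorial] at this ⊢
        linarith
      have hr4 : r ^ 4 ≤ 24 * Real.exp (1 * r) := by
        have := Real.pow_div_factorial_le_exp r hr 4
        norm_num [Nat.factorial] at this ⊢
        linarith
      calc (D g) ^ 2 ≤ _ := h3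
        _ = s ^ 2 * |A g| ^ 2 + s ^ 3 * (2 * C * r ^ 2 * |A g| + s * (C ^ 2 * r ^ 4)) := by ring
        _ ≤ s ^ 2 * |A g| ^ 2 + s ^ 3 * (2 * C * r ^ 2 * (K * r) + 1 * (C ^ 2 * r ^ 4)) := by
            gcongr
        _ = s ^ 2 * |A g| ^ 2 + s ^ 3 * (2 * C * K * r ^ 3 + C ^ 2 * r ^ 4) := by ring
        _ ≤ s ^ 2 * |A g| ^ 2 + s ^ 3 * (2 * C * K * (6 * Real.exp (1 * r))
              + C ^ 2 * (24 * Real.exp (1 * r))) := by gcongr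
        _ = _ := by rw [sq_abs]; ring
    have h0 := gc_exp_le (D g - e)
    have hUg : U g = (6 * K * C + 12 * C ^ 2) * Real.exp (1 * r)
      + 6 * Real.exp (2 * K * m) * Real.exp (2 * K * r) := rfl
    rw [hUg]
    nlinarith [h0, hcube, hsq]
  have hexp_int : Integrable (fun g => Real.exp (D g - e)) (stdGaussian E) := by
    have := (gc_int_exp_lip hL x s).mul_const (Real.exp (- F x - e))
    refine this.congr (Filter.Eventually.of_forall fun g => ?_)
    simp only [D]
    rw [← Real.exp_add]; congr 1; ring
  have hi1 : Integrable (fun g => (1 - e + e ^ 2 / 2) + (1 - e) * D g) (stdGaussian E) :=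
    (integrable_const _).add (hDint.const_mul _)
  have hi2 : Integrable (fun g => (1 - e + e ^ 2 / 2) + (1 - e) * D g + s ^ 2 / 2 * (A g) ^ 2)
    (stdGaussian E) := hi1.add (hAint.const_mul _)
  have hmain : ∫ g, Real.exp (D g - e) ∂(stdGaussian E) ≤
      1 + s ^ 2 / 2 * ‖A‖ ^ 2 + s ^ 3 * ∫ g, U g ∂(stdGaussian E) := by
    have := integral_mono hexp_int (hi2.add (hU.const_mul (s ^ 3))) hpt
    refine this.trans ?_
    have e1 : ∫ g, ((1 - e + e ^ 2 / 2) + (1 - e) * D g + s ^ 2 / 2 * (A g) ^ 2 + s ^ 3 * U g)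
        ∂(stdGaussian E) = (1 - e + e ^ 2 / 2) + (1 - e) * e + s ^ 2 / 2 * ‖A‖ ^ 2
          + s ^ 3 * ∫ g, U g ∂(stdGaussian E) := by
      rw [integral_add hi2 (hU.const_mul _), integral_add hi1 (hAint.const_mul _),
        integral_add (integrable_const _) (hDint.const_mul _), integral_const_mul,
        integral_const_mul, integral_const_mul, hAvar, ← he]
      simp
    refine le_trans (le_of_eq e1) ?_
    nlinarith [sq_nonneg e]
  have hA2 : ‖A‖ ^ 2 ≤ (K : ℝ) ^ 2 := by gcongr
  have hmean : ∫ g, F (x + s • g) ∂(stdGaussian E) = F x + e := by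
    rw [he]; simp only [D]
    rw [integral_sub (gc_int_lip hL x s) (integrable_const _)]; simp
  have hfac : ∫ g, Real.exp (F (x + s • g)) ∂(stdGaussian E)
      = Real.exp (F x + e) * ∫ g, Real.exp (D g - e) ∂(stdGaussian E) := by
    rw [← integral_const_mul]; congr 1; ext g
    rw [← Real.exp_add]; congr 1; simp only [D]; ring
  rw [hfac, hmean, Real.exp_add (F x + e)]
  gcongr
  refine hmain.trans (le_trans ?_ (Real.add_one_le_exp _))
  nlinarith [mul_le_mul_of_nonneg_left hA2 (sq_nonneg s)]

lemma gc_iter (K : ℝ≥0) (C : ℝ) (s b : ℝ)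
    (hstep : ∀ F : E → ℝ, GCGood K C F → ∀ x : E,
    ∫ g, Real.exp (F (x + s • g)) ∂(stdGaussian E)
      ≤ Real.exp (∫ g, F (x + s • g) ∂(stdGaussian E) + b)) (k : ℕ) :
    ∀ F : E → ℝ, GCGood K C F → ∀ x : E,
    ∫ g, Real.exp (F (x + (√k * s) • g)) ∂(stdGaussian E)
      ≤ Real.exp (∫ g, F (x + (√k * s) • g) ∂(stdGaussian E) + k * b) := by
  induction k with
  | zero => intro F hF x; simp
  | succ k ih =>
    intro F hF x
    have habc : (√k * s) ^ 2 + s ^ 2 = (√((k + 1 : ℕ) : ℝ) * s) ^ 2 := by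
      rw [mul_pow, mul_pow, Real.sq_sqrt (by positivity), Real.sq_sqrt (by positivity)]
      push_cast; ring
    have hL := hF.1
    have hT := gc_good_avg hF s
    rw [gc_stable (f := fun y => Real.exp (F y)) _ _ _ habc (Real.continuous_exp.comp hL.continuous) x (gc_int_exp_lip hL x _),
      gc_stable _ _ _ habc hL.continuous x (gc_int_lip hL x _)]
    have h1 := ih _ hT x
    have hTb : LipschitzWith K (fun y => ∫ g, F (y + s • g) ∂(stdGaussian E) + b) := by
      have := hT.1
      refine LipschitzWith.of_dist_le_mul fun x y => ?_
      have := this.dist_le_mul x y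
      rwa [dist_add_right]
    calc ∫ g, ∫ g', Real.exp (F (x + (√k * s) • g + s • g')) ∂(stdGaussian E) ∂(stdGaussian E)
        ≤ ∫ g, Real.exp (∫ g', F (x + (√k * s) • g + s • g') ∂(stdGaussian E) + b)
            ∂(stdGaussian E) := by
          refine integral_mono_of_nonneg (Filter.Eventually.of_forall fun g =>
            integral_nonneg fun _ => (Real.exp_pos _).le) (gc_int_exp_lip hTb x (√k * s))
            (Filter.Eventually.of_forall fun g => hstep F hF _)
      _ = (∫ g, Real.exp (∫ g', F (x + (√k * s) • g + s • g') ∂(stdGaussian E))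
            ∂(stdGaussian E)) * Real.exp b := by
          rw [← integral_mul_const]; simp only [Real.exp_add]
      _ ≤ _ := by
          refine (mul_le_mul_of_nonneg_right h1 (Real.exp_pos b).le).trans ?_
          rw [← Real.exp_add]
          apply Real.exp_le_exp.2
          push_cast
          linarith

lemma gc_good_mgf {K : ℝ≥0} {C : ℝ} (hC : 0 ≤ C) {F : E → ℝ} (hF : GCGood K C F) :
    ∫ g, Real.exp (F g) ∂(stdGaussian E)
      ≤ Real.exp (∫ g, F g ∂(stdGaussian E) + K ^ 2 / 2) := by
  obtain ⟨B, hB⟩ := gc_step (E := E) K C hC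
  have key : ∀ N : ℕ, ∫ g, Real.exp (F g) ∂(stdGaussian E)
      ≤ Real.exp (∫ g, F g ∂(stdGaussian E) + K ^ 2 / 2 + B * (√((N : ℝ) + 1))⁻¹) := by
    intro N
    have hN : (0 : ℝ) < (N : ℝ) + 1 := by positivity
    have hsN : 0 < √((N : ℝ) + 1) := Real.sqrt_pos.2 hN
    have h1s : 1 ≤ √((N : ℝ) + 1) := Real.one_le_sqrt.2 (by linarith [Nat.cast_nonneg (α := ℝ) N])
    have h := gc_iter (E := E) K C (√((N : ℝ) + 1))⁻¹ _
      (hB (√((N : ℝ) + 1))⁻¹ (by positivity) (inv_le_one_of_one_le₀ h1s)) (N + 1) F hF 0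
    have e1 : √((N + 1 : ℕ) : ℝ) * (√((N : ℝ) + 1))⁻¹ = 1 := by
      push_cast; exact mul_inv_cancel₀ hsN.ne'
    rw [e1] at h
    simp only [zero_add, one_smul] at h
    refine h.trans (le_of_eq ?_)
    congr 1
    have h2 : ((√((N : ℝ) + 1))⁻¹) ^ 2 * ((N : ℝ) + 1) = 1 := by
      rw [inv_pow, Real.sq_sqrt hN.le]; exact inv_mul_cancel₀ hN.ne'
    push_cast
    linear_combination (K ^ 2 / 2 + (√((N : ℝ) + 1))⁻¹ * B) * h2
  have hlim : Filter.Tendsto (fun N : ℕ => Real.exp (∫ g, F g ∂(stdGaussian E) + K ^ 2 / 2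
      + B * (√((N : ℝ) + 1))⁻¹)) Filter.atTop
      (nhds (Real.exp (∫ g, F g ∂(stdGaussian E) + K ^ 2 / 2 + B * 0))) := by
    refine (Real.continuous_exp.tendsto _).comp (Filter.Tendsto.add tendsto_const_nhds
      (Filter.Tendsto.const_mul _ ?_))
    refine Filter.Tendsto.inv_tendsto_atTop ?_
    refine Real.tendsto_sqrt_atTop.comp ?_
    exact Filter.tendsto_atTop_add_const_right _ _ tendsto_natCast_atTop_atTop
  have := ge_of_tendsto' hlim key
  simpa using this

open scoped Convolution in
lemma gc_mollify {K : ℝ≥0} {F : E → ℝ} (hF : LipschitzWith K F) {ε : ℝ} (hε : 0 < ε) :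
    ∃ (C : ℝ) (G : E → ℝ), 0 ≤ C ∧ GCGood K C G ∧ ∀ x, |G x - F x| ≤ ε := by
  have hK1 : (0 : ℝ) < K + 1 := by positivity
  let φ : ContDiffBump (0 : E) := ⟨ε / (K + 1) / 2, ε / (K + 1), by positivity,
    by linarith [show 0 < ε / (K + 1) by positivity]⟩
  let ψ : E → ℝ := φ.normed volume
  have hψc : HasCompactSupport ψ := φ.hasCompactSupport_normed
  have hψd : ContDiff ℝ 1 ψ := φ.contDiff_normed
  have hψcont : Continuous ψ := hψd.continuous
  have hψ0 : ∀ x, 0 ≤ ψ x := fun x => φ.nonneg_normed x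
  have hψint : Integrable ψ := hψcont.integrable_of_hasCompactSupport hψc
  let G : E → ℝ := ψ ⋆[ContinuousLinearMap.lsmul ℝ ℝ, volume] F
  have hder : ∀ x, HasFDerivAt G
      ((fderiv ℝ ψ ⋆[ContinuousLinearMap.precompL E (ContinuousLinearMap.lsmul ℝ ℝ), volume] F) x)
      x := hψc.hasFDerivAt_convolution_left (ContinuousLinearMap.lsmul ℝ ℝ) hψd
        hF.continuous.locallyIntegrable
  set G' : E → E →L[ℝ] ℝ :=
    (fderiv ℝ ψ ⋆[ContinuousLinearMap.precompL E (ContinuousLinearMap.lsmul ℝ ℝ), volume] F) with hG'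
  have hdc : HasCompactSupport (fderiv ℝ ψ) := hψc.fderiv ℝ
  have hdcont : Continuous (fderiv ℝ ψ) := hψd.continuous_fderiv (by norm_num)
  have hdint : Integrable (fun y => ‖fderiv ℝ ψ y‖) :=
    (hdcont.integrable_of_hasCompactSupport hdc).norm
  have hexG : ∀ x, Integrable (fun y => ψ y * F (x - y)) := fun x =>
    Continuous.integrable_of_hasCompactSupport
      (hψcont.mul (hF.continuous.comp (by fun_prop))) hψc.mul_right
  have hexG' : ∀ x, Integrable (fun y =>
      (ContinuousLinearMap.precompL E (ContinuousLinearMap.lsmul ℝ ℝ)) (fderiv ℝ ψ y) (F (x - y))) :=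
    fun x => hdc.convolutionExists_left _ hdcont hF.continuous.locallyIntegrable x
  have hGdef : ∀ x, G x = ∫ y, ψ y * F (x - y) := fun x => rfl
  have hlipy : ∀ x x' y, |F (x - y) - F (x' - y)| ≤ K * ‖x - x'‖ := fun x x' y => by
    have := hF.dist_le_mul (x - y) (x' - y)
    simpa [Real.dist_eq, dist_eq_norm] using this
  have hGL : LipschitzWith K G := by
    refine LipschitzWith.of_dist_le_mul fun x x' => ?_
    rw [Real.dist_eq, hGdef, hGdef, ← integral_sub (hexG x) (hexG x')]
    have := norm_integral_le_of_norm_le (f := fun y => ψ y * F (x - y) - ψ y * F (x' - y))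
      (hψint.mul_const (K * ‖x - x'‖)) (Filter.Eventually.of_forall fun y => by
        rw [← mul_sub, Real.norm_eq_abs, abs_mul, abs_of_nonneg (hψ0 y)]
        exact mul_le_mul_of_nonneg_left (hlipy x x' y) (hψ0 y))
    rw [integral_mul_const] at this
    have h1 : ∫ y, ψ y = 1 := φ.integral_normed
    rw [h1, one_mul] at this
    rw [dist_eq_norm]; exact this
  set C : ℝ := (∫ y, ‖fderiv ℝ ψ y‖) * K with hC
  have hC0 : 0 ≤ C := mul_nonneg (integral_nonneg fun _ => norm_nonneg _) K.2
  have hG'L : ∀ x x', ‖G' x - G' x'‖ ≤ C * ‖x - x'‖ := by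
    intro x x'
    have e : G' x - G' x' = ∫ y, ((ContinuousLinearMap.precompL E (ContinuousLinearMap.lsmul ℝ ℝ))
        (fderiv ℝ ψ y) (F (x - y)) - (ContinuousLinearMap.precompL E (ContinuousLinearMap.lsmul ℝ ℝ))
        (fderiv ℝ ψ y) (F (x' - y))) := (integral_sub (hexG' x) (hexG' x')).symm
    rw [e]
    have := norm_integral_le_of_norm_le (f := fun y =>
        ((ContinuousLinearMap.precompL E (ContinuousLinearMap.lsmul ℝ ℝ))
        (fderiv ℝ ψ y) (F (x - y)) - (ContinuousLinearMap.precompL E (ContinuousLinearMap.lsmul ℝ ℝ))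
        (fderiv ℝ ψ y) (F (x' - y))))
      (hdint.mul_const (K * ‖x - x'‖)) (Filter.Eventually.of_forall fun y => by
        have e2 : ((ContinuousLinearMap.precompL E (ContinuousLinearMap.lsmul ℝ ℝ))
          (fderiv ℝ ψ y) (F (x - y)) - (ContinuousLinearMap.precompL E
            (ContinuousLinearMap.lsmul ℝ ℝ)) (fderiv ℝ ψ y) (F (x' - y)))
            = (F (x - y) - F (x' - y)) • fderiv ℝ ψ y := by
          ext v
          simp [ContinuousLinearMap.precompL_apply]
          ring
        rw [e2, norm_smul, Real.norm_eq_abs, mul_comm]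
        exact mul_le_mul_of_nonneg_left (hlipy x x' y) (norm_nonneg _))
    rw [integral_mul_const] at this
    refine this.trans (le_of_eq ?_)
    rw [hC]; ring
  refine ⟨C, G, hC0, ⟨hGL, fun x => ⟨G' x, fun v => ?_⟩⟩, fun x => ?_⟩
  · have := Convex.norm_image_sub_le_of_norm_hasFDerivWithin_le' (𝕜 := ℝ) (f := G) (f' := G')
      (φ := G' x) (s := Metric.closedBall x ‖v‖) (C := C * ‖v‖) (x := x) (y := x + v)
      (fun z _ => (hder z).hasFDerivWithinAt)
      (fun z hz => (hG'L z x).trans (by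
        rw [mem_closedBall_iff_norm] at hz
        gcongr)) (convex_closedBall x ‖v‖) (by simp) (by simp)
    simp only [add_sub_cancel_left, Real.norm_eq_abs] at this
    calc _ ≤ _ := this
      _ = _ := by ring
  · have := ContDiffBump.dist_normed_convolution_le (φ := φ) (μ := volume) (g := F) (x₀ := x)
      (ε := ε) hF.continuous.aestronglyMeasurable (fun y hy => by
        have h1 := hF.dist_le_mul y x
        have h2 : dist y x < ε / (K + 1) := hy
        refine h1.trans ?_
        calc (K : ℝ) * dist y x ≤ (K + 1) * (ε / (K + 1)) := by
              gcongr
              · linarith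
          _ = ε := by field_simp)
    rwa [Real.dist_eq] at this

lemma gc_mgf {K : ℝ≥0} {F : E → ℝ} (hF : LipschitzWith K F) :
    ∫ g, Real.exp (F g) ∂(stdGaussian E)
      ≤ Real.exp (∫ g, F g ∂(stdGaussian E) + K ^ 2 / 2) := by
  have hi : ∀ {G : E → ℝ}, LipschitzWith K G → Integrable G (stdGaussian E) := fun hG => by
    simpa using gc_int_lip hG 0 1
  have hie : ∀ {G : E → ℝ}, LipschitzWith K G → Integrable (fun g => Real.exp (G g))
      (stdGaussian E) := fun hG => by
    simpa using gc_int_exp_lip hG 0 1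
  have key : ∀ ε : ℝ, 0 < ε → ∫ g, Real.exp (F g) ∂(stdGaussian E)
      ≤ Real.exp (∫ g, F g ∂(stdGaussian E) + K ^ 2 / 2 + 2 * ε) := by
    intro ε hε
    obtain ⟨C, G, hC, hG, hGF⟩ := gc_mollify hF hε
    have h1 := gc_good_mgf hC hG
    have h2 : ∫ g, G g ∂(stdGaussian E) ≤ ∫ g, F g ∂(stdGaussian E) + ε := by
      have := integral_mono (hi hG.1) ((hi hF).add (integrable_const ε))
        (fun g => by have := abs_le.1 (hGF g); simp; linarith)
      refine this.trans (le_of_eq ?_)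
      rw [integral_add' (hi hF) (integrable_const ε)]; simp
    have h3 : ∫ g, Real.exp (F g) ∂(stdGaussian E)
        ≤ (∫ g, Real.exp (G g) ∂(stdGaussian E)) * Real.exp ε := by
      rw [← integral_mul_const]
      refine integral_mono (hie hF) ((hie hG.1).mul_const _) fun g => ?_
      simp only
      rw [← Real.exp_add]
      have := abs_le.1 (hGF g)
      exact Real.exp_le_exp.2 (by linarith)
    refine h3.trans ((mul_le_mul_of_nonneg_right h1 (Real.exp_pos _).le).trans ?_)
    rw [← Real.exp_add]
    exact Real.exp_le_exp.2 (by linarith)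
  have hlim : Filter.Tendsto (fun ε : ℝ => Real.exp (∫ g, F g ∂(stdGaussian E) + K ^ 2 / 2 + 2 * ε))
      (nhdsWithin 0 (Set.Ioi 0)) (nhds (Real.exp (∫ g, F g ∂(stdGaussian E) + K ^ 2 / 2 + 2 * 0))) := by
    refine Filter.Tendsto.mono_left (Continuous.tendsto (by fun_prop) _) nhdsWithin_le_nhds
  have := ge_of_tendsto hlim (Filter.eventually_of_mem self_mem_nhdsWithin key)
  simpa using this

lemma gc_subG {K : ℝ≥0} {F : E → ℝ} (hF : LipschitzWith K F) :
    HasSubgaussianMGF (fun g => F g - ∫ g', F g' ∂(stdGaussian E)) (K ^ 2) (stdGaussian E) := by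
  set e := ∫ g', F g' ∂(stdGaussian E) with he
  have hL : ∀ t : ℝ, LipschitzWith (‖t‖₊ * K) (fun g => t * (F g - e)) := fun t => by
    refine LipschitzWith.of_dist_le_mul fun x y => ?_
    have := hF.dist_le_mul x y
    rw [Real.dist_eq] at this ⊢
    rw [← mul_sub, abs_mul]
    simp only [sub_sub_sub_cancel_right, NNReal.coe_mul, coe_nnnorm, Real.norm_eq_abs, mul_assoc]
    gcongr
  have hi : Integrable F (stdGaussian E) := by simpa using gc_int_lip hF 0 1
  refine ⟨fun t => ?_, fun t => ?_⟩
  · simpa using gc_int_exp_lip (hL t) 0 1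
  · have := gc_mgf (hL t)
    rw [mgf]
    refine this.trans (Real.exp_le_exp.2 (le_of_eq ?_))
    rw [integral_const_mul, integral_sub hi (integrable_const _), ← he]
    simp [mul_pow]
    ring

end GaussConc
lemma lq_ne_top (q : ℝ≥0∞) {L : ℕ} (v : Fin L → ℝ) : eLpNorm v q Measure.count ≠ ∞ :=
  (MemLp.of_discrete (p := q) (μ := Measure.count) (f := v)).eLpNorm_ne_top

lemma lq_nonneg (q : ℝ≥0∞) {L : ℕ} (v : Fin L → ℝ) : 0 ≤ lqNorm q v := ENNReal.toReal_nonneg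

lemma lq_add_le {q : ℝ≥0∞} (hq : 1 ≤ q) {L : ℕ} (u v : Fin L → ℝ) :
    lqNorm q (u + v) ≤ lqNorm q u + lqNorm q v := by
  unfold lqNorm
  rw [← ENNReal.toReal_add (lq_ne_top q u) (lq_ne_top q v)]
  exact ENNReal.toReal_mono (by simp [lq_ne_top]) (eLpNorm_add_le
    (MemLp.of_discrete (p := q)).1 (MemLp.of_discrete (p := q)).1 hq)

lemma lq_smul (q : ℝ≥0∞) {L : ℕ} (c : ℝ) (v : Fin L → ℝ) :
    lqNorm q (c • v) = |c| * lqNorm q v := by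
  unfold lqNorm
  rw [eLpNorm_const_smul, ENNReal.toReal_mul]
  simp

lemma lq_mono (q : ℝ≥0∞) {L : ℕ} {u v : Fin L → ℝ} (h : ∀ j, |u j| ≤ v j) :
    lqNorm q u ≤ lqNorm q v :=
  ENNReal.toReal_mono (lq_ne_top q v) (eLpNorm_mono_real h)

noncomputable def scoreT {n L : ℕ} (X : Fin n → Fin L → ℝ) (q : ℝ≥0∞) (w : Fin n → ℝ) : ℝ :=
  lqNorm q (fun j => (1 / (n : ℝ)) * ∑ i, X i j * w i)

lemma scoreT_smul {n L : ℕ} (X : Fin n → Fin L → ℝ) (q : ℝ≥0∞) {σ : ℝ} (hσ : 0 < σ)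
    (w : Fin n → ℝ) : scoreT X q (σ • w) = σ * scoreT X q w := by
  unfold scoreT
  have := lq_smul q σ (fun j => (1 / (n : ℝ)) * ∑ i, X i j * w i)
  rw [abs_of_pos hσ] at this
  rw [← this]
  congr 1; ext j
  simp only [Pi.smul_apply, smul_eq_mul, Finset.mul_sum]
  refine Finset.sum_congr rfl fun i _ => by ring

lemma scoreT_bound {n L : ℕ} (hn : 1 ≤ n) (X : Fin n → Fin L → ℝ) (q : ℝ≥0∞)
    (v : EuclideanSpace ℝ (Fin n)) :
    scoreT X q (fun i => v i) ≤ (Nq q X / √n) * ‖v‖ := by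
  have hn0 : (0 : ℝ) < n := by exact_mod_cast hn
  have hsn : 0 < √(n : ℝ) := Real.sqrt_pos.2 hn0
  have e : (Nq q X / √n) * ‖v‖ = lqNorm q ((‖v‖ / √n) •
      (fun j => Real.sqrt ((1 / (n : ℝ)) * ∑ i, (X i j) ^ 2))) := by
    rw [lq_smul, abs_of_nonneg (by positivity)]
    unfold Nq; ring
  rw [e]
  refine lq_mono q fun j => ?_
  simp only [Pi.smul_apply, smul_eq_mul]
  have hcs : |∑ i, X i j * v i| ≤ √(∑ i, (X i j) ^ 2) * ‖v‖ := by
    rw [EuclideanSpace.norm_eq, ← Real.sqrt_mul (by positivity)]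
    apply Real.abs_le_sqrt
    simpa using Finset.sum_mul_sq_le_sq_mul_sq Finset.univ (fun i => X i j) (fun i => v i)
  rw [abs_mul, abs_of_pos (by positivity), Real.sqrt_mul (by positivity), Real.sqrt_div (by norm_num),
    Real.sqrt_one]
  calc 1 / (n : ℝ) * |∑ i, X i j * v i| ≤ 1 / (n : ℝ) * (√(∑ i, (X i j) ^ 2) * ‖v‖) := by gcongr
    _ = 1 / (√n * √n) * (√(∑ i, (X i j) ^ 2) * ‖v‖) := by rw [Real.mul_self_sqrt hn0.le]
    _ = _ := by field_simp

lemma scoreT_sub_le {n L : ℕ} (X : Fin n → Fin L → ℝ) {q : ℝ≥0∞} (hq : 1 ≤ q)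
    (u v : Fin n → ℝ) : scoreT X q u ≤ scoreT X q (u - v) + scoreT X q v := by
  unfold scoreT
  refine le_trans (le_of_eq ?_) (lq_add_le hq _ _)
  congr 1; ext j
  simp only [Pi.add_apply, Pi.sub_apply, ← mul_add, ← Finset.sum_add_distrib]
  congr 1
  refine Finset.sum_congr rfl fun i _ => by ring

lemma Nq_div_nonneg {n L : ℕ} (X : Fin n → Fin L → ℝ) (q : ℝ≥0∞) : 0 ≤ Nq q X / √n :=
  div_nonneg (lq_nonneg _ _) (Real.sqrt_nonneg _)

noncomputable def scoreK {n L : ℕ} (X : Fin n → Fin L → ℝ) (q : ℝ≥0∞) : ℝ≥0 :=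
  (Nq q X / √n).toNNReal

lemma scoreK_coe {n L : ℕ} (X : Fin n → Fin L → ℝ) (q : ℝ≥0∞) :
    (scoreK X q : ℝ) = Nq q X / √n := Real.coe_toNNReal _ (Nq_div_nonneg X q)

lemma gaussianVec_def (n : ℕ) (σ : ℝ) :
    gaussianVec n σ = Measure.pi (fun _ => gaussianReal 0 (σ ^ 2).toNNReal) := by
  rw [Real.toNNReal_of_nonneg (sq_nonneg σ)]
  rfl

lemma scoreT_lip {n L : ℕ} (hn : 1 ≤ n) (X : Fin n → Fin L → ℝ) {q : ℝ≥0∞} (hq : 1 ≤ q) :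
    LipschitzWith (scoreK X q)
      (fun v : EuclideanSpace ℝ (Fin n) => scoreT X q (fun i => v i)) := by
  refine LipschitzWith.of_le_add_mul _ fun u v => ?_
  have h1 := scoreT_sub_le X hq (fun i => u i) (fun i => v i)
  have h2 := scoreT_bound hn X q (u - v)
  rw [dist_eq_norm]
  have h3 : scoreT X q ((fun i => u i) - fun i => v i) = scoreT X q (fun i => (u - v) i) := rfl
  rw [h3] at h1
  rw [scoreK_coe]
  linarith

lemma gaussianVec_one_map (n : ℕ) :
    (gaussianVec n 1).map (WithLp.toLp 2) = stdGaussian (EuclideanSpace ℝ (Fin n)) := by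
  rw [← map_pi_eq_stdGaussian, gaussianVec_def]
  simp

instance gaussianVec_prob (n : ℕ) (σ : ℝ) : IsProbabilityMeasure (gaussianVec n σ) := by
  rw [gaussianVec_def]; infer_instance

lemma gaussianVec_eq_map (n : ℕ) (σ : ℝ) :
    gaussianVec n σ = (gaussianVec n 1).map (fun w => σ • w) := by
  have hm : (gaussianReal 0 ((1 : ℝ) ^ 2).toNNReal).map (fun x => σ * x)
      = gaussianReal 0 (σ ^ 2).toNNReal := by
    rw [gaussianReal_map_const_mul]
    congr 1
    · simp
    · rw [Real.toNNReal_of_nonneg (sq_nonneg σ)]; simp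
  have hp : IsProbabilityMeasure ((gaussianReal 0 ((1 : ℝ) ^ 2).toNNReal).map (fun x => σ * x)) := by
    rw [hm]; infer_instance
  have h := Measure.pi_map_pi (ι := Fin n) (μ := fun _ => gaussianReal 0 ((1 : ℝ) ^ 2).toNNReal)
    (f := fun _ x => σ * x) (fun _ => by fun_prop)
  have e : (fun w : Fin n → ℝ => σ • w) = fun x i => σ * x i := by ext; simp
  rw [gaussianVec_def, gaussianVec_def, e, h, hm]

lemma scoreT_subG {n L : ℕ} (hn : 1 ≤ n) (X : Fin n → Fin L → ℝ) {q : ℝ≥0∞} (hq : 1 ≤ q) :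
    ∃ e : ℝ, HasSubgaussianMGF (fun w => scoreT X q w - e) (scoreK X q ^ 2) (gaussianVec n 1) := by
  have h := gc_subG (scoreT_lip hn X hq)
  refine ⟨_, HasSubgaussianMGF.of_map (Y := WithLp.toLp 2) (μ := gaussianVec n 1)
    (by fun_prop) (by rw [gaussianVec_one_map]; exact h)⟩

lemma scoreT_meas {n L : ℕ} (hn : 1 ≤ n) (X : Fin n → Fin L → ℝ) {q : ℝ≥0∞} (hq : 1 ≤ q) :
    Measurable (scoreT X q) := by
  have h := (scoreT_lip hn X hq).continuous
  have h2 : Continuous (fun w : Fin n → ℝ => (WithLp.toLp 2 w : EuclideanSpace ℝ (Fin n))) := by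
    fun_prop
  exact (h.comp h2).measurable

lemma tau_eq {n L : ℕ} (X : Fin n → Fin L → ℝ) (σ : ℝ) (q : ℝ≥0∞) {a : ℝ} :
    tau X σ q a = σ * (scoreK X q * √(2 * Real.log (1 / a))) := by
  unfold tau
  have : (2 / (n : ℝ)) * Real.log (1 / a) = (2 * Real.log (1 / a)) / n := by ring
  rw [this, Real.sqrt_div' _ (by positivity)]
  rw [scoreK_coe]
  ring

lemma exp_calc {a : ℝ} (h0 : 0 < a) (h1 : a < 1) :
    Real.exp (-(√(2 * Real.log (1 / a))) ^ 2 / 2) = a := by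
  have : 0 ≤ Real.log (1 / a) := Real.log_nonneg (by rw [le_div_iff₀ h0]; linarith)
  rw [Real.sq_sqrt (by positivity)]
  have e : -(2 * Real.log (1 / a)) / 2 = Real.log a := by
    rw [one_div, Real.log_inv]; ring
  rw [e, Real.exp_log h0]

lemma tail_one {n L : ℕ} (hn : 1 ≤ n) (X : Fin n → Fin L → ℝ) {q : ℝ≥0∞} (hq : 1 ≤ q) {σ e a : ℝ}
    (hσ : 0 < σ) (h0 : 0 < a) (h1 : a < 1) (hK : 0 < scoreK X q)
    (he : HasSubgaussianMGF (fun w => scoreT X q w - e) (scoreK X q ^ 2) (gaussianVec n 1)) :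
    (gaussianVec n σ).real {w | σ * e + tau X σ q a ≤ scoreT X q w} ≤ a := by
  have hm : MeasurableSet {w | σ * e + tau X σ q a ≤ scoreT X q w} :=
    measurableSet_le measurable_const (scoreT_meas hn X hq)
  rw [gaussianVec_eq_map, map_measureReal_apply (by fun_prop) hm]
  set ℓ := √(2 * Real.log (1 / a)) with hℓ
  have h := he.measure_ge_le (ε := scoreK X q * ℓ) (by positivity)
  have hset : (fun w : Fin n → ℝ => σ • w) ⁻¹' {w | σ * e + tau X σ q a ≤ scoreT X q w}
      = {w | (scoreK X q : ℝ) * ℓ ≤ scoreT X q w - e} := by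
    ext w
    simp only [Set.mem_preimage, Set.mem_ofPred_eq, scoreT_smul X q hσ, tau_eq]
    rw [← mul_add, mul_le_mul_iff_right₀ hσ]
    constructor <;> intro h <;> linarith
  rw [hset]
  refine h.trans (le_of_eq ?_)
  have hK' : (scoreK X q : ℝ) ≠ 0 := by exact_mod_cast hK.ne'
  rw [← exp_calc h0 h1, ← hℓ]
  congr 1
  push_cast
  field_simp

lemma tail_two {n L R : ℕ} (hn : 1 ≤ n) (hR : 1 ≤ R) (X : Fin n → Fin L → ℝ) {q : ℝ≥0∞}
    (hq : 1 ≤ q) {e a : ℝ} (h0 : 0 < a) (h1 : a < 1) (hK : 0 < scoreK X q)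
    (he : HasSubgaussianMGF (fun w => scoreT X q w - e) (scoreK X q ^ 2) (gaussianVec n 1)) :
    (Measure.pi (fun _ : Fin R => gaussianVec n 1)).real
      {z | √R * (scoreK X q * √(2 * Real.log (1 / a))) ≤ ∑ r, (e - scoreT X q (z r))} ≤ a := by
  set ℓ := √(2 * Real.log (1 / a)) with hℓ
  have hind : iIndepFun (fun (r : Fin R) (z : Fin R → Fin n → ℝ) => e - scoreT X q (z r))
      (Measure.pi (fun _ : Fin R => gaussianVec n 1)) :=
    iIndepFun_pi (X := fun (_ : Fin R) w => e - scoreT X q w)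
      (fun _ => (measurable_const.sub (scoreT_meas hn X hq)).aemeasurable)
  have hsub : ∀ r ∈ (Finset.univ : Finset (Fin R)), HasSubgaussianMGF
      (fun z : Fin R → Fin n → ℝ => e - scoreT X q (z r)) (scoreK X q ^ 2)
      (Measure.pi (fun _ : Fin R => gaussianVec n 1)) := by
    intro r _
    have hn' := he.neg
    have := HasSubgaussianMGF.of_map (Y := Function.eval r)
      (μ := Measure.pi (fun _ : Fin R => gaussianVec n 1)) (measurable_pi_apply r).aemeasurable
      (by rw [(measurePreserving_eval (fun _ : Fin R => gaussianVec n 1) r).map_eq]; exact hn')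
    refine this.congr (Filter.Eventually.of_forall fun z => ?_)
    simp
  have h := (HasSubgaussianMGF.sum_of_iIndepFun hind hsub).measure_ge_le
    (ε := √R * (scoreK X q * ℓ)) (by positivity)
  refine h.trans (le_of_eq ?_)
  have hK' : (scoreK X q : ℝ) ≠ 0 := by exact_mod_cast hK.ne'
  have hR0 : (0 : ℝ) < R := by exact_mod_cast hR
  rw [← exp_calc h0 h1, ← hℓ]
  congr 1
  simp only [Finset.sum_const, Finset.card_univ, Fintype.card_fin, nsmul_eq_mul]
  push_cast
  rw [mul_pow, Real.sq_sqrt hR0.le]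
  field_simp

/-- Theorem 2.1, Type I error. -/
theorem type_one_error
    (n L R k p m : ℕ) (hn : 1 ≤ n) (hL : 1 ≤ L) (hR : 1 ≤ R)
    (hk : 1 ≤ k) (hp : 1 ≤ p) (hm : 1 ≤ m)
    (X : Fin n → Fin L → ℝ) (g : (Fin k → ℝ) → (Fin p → ℝ) → ℝ)
    (V : Fin n → Fin k → ℝ) (θs : Fin p → ℝ) (σ : ℝ) (hσ : 0 < σ)
    (h : (Fin p → ℝ) → Fin m → ℝ) (Ω : Set (Fin m → ℝ))
    (hΩne : Ω.Nonempty) (hΩcl : IsClosed Ω)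
    (hΘ0 : {θ : Fin p → ℝ | h θ ∈ Ω}.Nonempty)
    (q : ℝ≥0∞) (hq : 1 ≤ q)
    (α α₁ α₂ : ℝ) (hα₁ : 0 < α₁) (hα₂ : 0 < α₂) (hsum : α₁ + α₂ = α)
    (hα : α ∈ Set.Ioo (0 : ℝ) 1)
    (hnull : h θs ∈ Ω) :
    (((gaussianVec n σ).prod (Measure.pi (fun _ : Fin R => gaussianVec n 1)))
        {wz : (Fin n → ℝ) × (Fin R → Fin n → ℝ) |
          ∀ θh μh, OptimalP2 X g V (fun i => g (V i) θs + wz.1 i) h Ω q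
              (rThresh X σ q α₁ α₂ wz.2) θh μh →
            lqNorm q (fun j =>
                (1 / (n : ℝ)) * ∑ i, X i j * ((g (V i) θs + wz.1 i) - g (V i) θh))
              ≤ rThresh X σ q α₁ α₂ wz.2}).toReal ≥ 1 - α := by
  have hset : ∀ wz : (Fin n → ℝ) × (Fin R → Fin n → ℝ),
      scoreT X q wz.1 ≤ rThresh X σ q α₁ α₂ wz.2 →
      wz ∈ {wz : (Fin n → ℝ) × (Fin R → Fin n → ℝ) |
          ∀ θh μh, OptimalP2 X g V (fun i => g (V i) θs + wz.1 i) h Ω q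
              (rThresh X σ q α₁ α₂ wz.2) θh μh →
            lqNorm q (fun j =>
                (1 / (n : ℝ)) * ∑ i, X i j * ((g (V i) θs + wz.1 i) - g (V i) θh))
              ≤ rThresh X σ q α₁ α₂ wz.2} := by
    intro wz hwz θh μh hopt
    obtain ⟨⟨hf1, hf2, hf3⟩, hmin⟩ := hopt
    have h0 : μh ≤ 0 := by
      apply hmin θs 0
      refine ⟨?_, hnull, le_refl _⟩
      simp only [add_sub_cancel_left, add_zero]
      exact hwz
    exact hf1.trans (by linarith)
  set S := {wz : (Fin n → ℝ) × (Fin R → Fin n → ℝ) |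
          ∀ θh μh, OptimalP2 X g V (fun i => g (V i) θs + wz.1 i) h Ω q
              (rThresh X σ q α₁ α₂ wz.2) θh μh →
            lqNorm q (fun j =>
                (1 / (n : ℝ)) * ∑ i, X i j * ((g (V i) θs + wz.1 i) - g (V i) θh))
              ≤ rThresh X σ q α₁ α₂ wz.2} with hS
  obtain ⟨hα0, hα1⟩ := hα
  have hn0 : (0 : ℝ) < n := by exact_mod_cast hn
  have hR0 : (0 : ℝ) < R := by exact_mod_cast hR
  have hsR : 0 < √(R : ℝ) := Real.sqrt_pos.2 hR0
  rcases (zero_le (a := scoreK X q)).eq_or_lt with hK | hK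
  · have hall : S = Set.univ := by
      refine Set.eq_univ_of_forall fun wz => hset wz ?_
      have hb := scoreT_bound hn X q (WithLp.toLp 2 wz.1)
      have hK0 : Nq q X / √n = 0 := by
        have := congrArg NNReal.toReal hK
        rw [scoreK_coe] at this
        simpa using this.symm
      rw [hK0, zero_mul] at hb
      refine le_trans hb ?_
      unfold rThresh
      rw [tau_eq, tau_eq]
      have : 0 ≤ ∑ r, lqNorm q (fun j => (1 / (n : ℝ)) * ∑ i, X i j * wz.2 r i) :=
        Finset.sum_nonneg fun r _ => lq_nonneg _ _
      positivity
    rw [hall]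
    simp
    linarith
  obtain ⟨e, he⟩ := scoreT_subG hn X hq
  have t1 := tail_one hn X hq hσ hα₁ (by linarith) hK he
  have t2 := tail_two (R := R) hn hR X hq hα₂ (by linarith) hK he
  set B1 := {w | σ * e + tau X σ q α₁ ≤ scoreT X q w} with hB1
  set B2 := {z : Fin R → Fin n → ℝ | √R * (scoreK X q * √(2 * Real.log (1 / α₂)))
    ≤ ∑ r, (e - scoreT X q (z r))} with hB2
  set P := (gaussianVec n σ).prod (Measure.pi (fun _ : Fin R => gaussianVec n 1)) with hP
  have hcov : (Set.univ : Set ((Fin n → ℝ) × (Fin R → Fin n → ℝ))) ⊆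
      S ∪ (B1 ×ˢ Set.univ ∪ Set.univ ×ˢ B2) := by
    rintro ⟨w, z⟩ -
    by_cases h1 : w ∈ B1
    · exact Or.inr (Or.inl ⟨h1, trivial⟩)
    by_cases h2 : z ∈ B2
    · exact Or.inr (Or.inr ⟨trivial, h2⟩)
    refine Or.inl (hset _ ?_)
    simp only [hB1, hB2, Set.mem_ofPred_eq, not_le] at h1 h2
    rw [Finset.sum_sub_distrib] at h2
    simp only [Finset.sum_const, Finset.card_univ, Fintype.card_fin, nsmul_eq_mul] at h2
    have hr : rThresh X σ q α₁ α₂ z = (σ / R) * ∑ r, scoreT X q (z r)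
      + tau X σ q α₁ + (1 / √R) * tau X σ q α₂ := rfl
    simp only
    rw [hr]
    have h3 : σ * e ≤ (σ / R) * ∑ r, scoreT X q (z r) + (1 / √R) * tau X σ q α₂ := by
      rw [tau_eq]
      set κ := (scoreK X q : ℝ) * √(2 * Real.log (1 / α₂)) with hκ
      have e1 : (σ / R) * ∑ r, scoreT X q (z r) + (1 / √R) * (σ * κ)
          = (σ / R) * (∑ r, scoreT X q (z r) + √R * κ) := by
        have : (1 : ℝ) / √R = √R / R := by rw [Real.sqrt_div_self', one_div]
        rw [this]; ring
      have e2 : σ * e = (σ / R) * (R * e) := by field_simp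
      rw [e1, e2]
      have : 0 < σ / R := by positivity
      apply mul_le_mul_of_nonneg_left _ this.le
      linarith
    linarith
  have hu : P.real Set.univ ≤ P.real S + (P.real (B1 ×ˢ Set.univ) + P.real (Set.univ ×ˢ B2)) :=
    (measureReal_mono hcov).trans ((measureReal_union_le _ _).trans
      (by gcongr; exact measureReal_union_le _ _))
  have p1 : P.real (B1 ×ˢ Set.univ) = (gaussianVec n σ).real B1 := by
    rw [hP, measureReal_prod_prod]; simp
  have p2 : P.real (Set.univ ×ˢ B2) = (Measure.pi (fun _ : Fin R => gaussianVec n 1)).real B2 := by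
    rw [hP, measureReal_prod_prod]; simp
  rw [p1, p2] at hu
  have hone : P.real Set.univ = 1 := by simp [hP]
  change P.real S ≥ 1 - α
  linarith
end

section
/- (Lower bound on the expected maximum, eq. (lead)) Let W ~ N(0, I_n). Then for all L ≥ 20, E[‖(1/n)XᵀW‖_∞] ≥ (1/2)(1 − 1/e) √( (log L)/(4n²) · min_{j ≠ l, j,l ∈ {1,…,L}} ∑_{i=1}^n (X_{ij} − X_{il})² ). -/
open MeasureTheory ProbabilityTheory
open scoped ENNReal NNReal

lemma lqNorm_top_eq {L : ℕ} (v : Fin L → ℝ) : lqNorm ⊤ v = ‖v‖ := by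
  unfold lqNorm
  rw [eLpNorm_exponent_top, eLpNormEssSup_count]
  have h : (⨆ a, ‖v a‖ₑ) ≤ ENNReal.ofReal ‖v‖ := by
    apply iSup_le
    intro i
    rw [← ofReal_norm]
    exact ENNReal.ofReal_le_ofReal (norm_le_pi_norm v i)
  apply le_antisymm
  · exact ENNReal.toReal_le_of_le_ofReal (norm_nonneg _) h
  · refine (pi_norm_le_iff_of_nonneg ENNReal.toReal_nonneg).2 fun i => ?_
    rw [← toReal_enorm]
    exact ENNReal.toReal_mono (lt_of_le_of_lt h ENNReal.ofReal_lt_top).ne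
      (le_iSup (fun i => ‖v i‖ₑ) i)

lemma gv_eq (n : ℕ) : gaussianVec n 1 = Measure.pi (fun _ : Fin n => gaussianReal 0 1) := by
  unfold gaussianVec
  congr 1; ext1 i; congr 1; ext; simp; rfl

instance gv_prob (n : ℕ) : IsProbabilityMeasure (gaussianVec n 1) := by
  rw [gv_eq]; infer_instance

lemma gv_density (n : ℕ) : gaussianVec n 1 = (volume : Measure (Fin n → ℝ)).withDensity
    (fun w => ENNReal.ofReal (∏ i, gaussianPDFReal 0 1 (w i))) := by
  rw [gv_eq]
  refine Measure.pi_eq (fun s hs => ?_)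
  rw [withDensity_apply _ (MeasurableSet.univ_pi hs), volume_pi, Measure.restrict_pi_pi,
    ← ofReal_integral_eq_lintegral_ofReal]
  · rw [integral_fintype_prod_eq_prod (𝕜 := ℝ) (fun _ => gaussianPDFReal 0 1), ENNReal.ofReal_prod_of_nonneg]
    · refine Finset.prod_congr rfl fun i _ => ?_
      rw [gaussianReal_apply_eq_integral _ one_ne_zero]
    · intro i _
      exact integral_nonneg fun x => gaussianPDFReal_nonneg _ _ _
  · exact Integrable.fintype_prod (fun i => (integrable_gaussianPDFReal 0 1).restrict)
  · exact Filter.Eventually.of_forall fun w => Finset.prod_nonneg fun i _ => gaussianPDFReal_nonneg _ _ _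

lemma gv_integral (n : ℕ) (f : (Fin n → ℝ) → ℝ) :
    ∫ w, f w ∂(gaussianVec n 1) = ∫ w, (∏ i, gaussianPDFReal 0 1 (w i)) * f w := by
  rw [gv_density, integral_withDensity_eq_integral_toReal_smul]
  · refine integral_congr_ae (Filter.Eventually.of_forall fun w => ?_)
    simp only [smul_eq_mul]
    rw [ENNReal.toReal_ofReal]
    exact Finset.prod_nonneg fun i _ => gaussianPDFReal_nonneg _ _ _
  · have := measurable_gaussianPDFReal 0 1
    fun_prop
  · simp

lemma gv_dens_shift (n : ℕ) (w c : Fin n → ℝ) :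
    ∏ i, gaussianPDFReal 0 1 ((w + -c) i) =
      (∏ i, gaussianPDFReal 0 1 (w i)) * Real.exp (w ⬝ᵥ c - c ⬝ᵥ c / 2) := by
  have : w ⬝ᵥ c - c ⬝ᵥ c / 2 = ∑ i, (w i * c i - c i * c i / 2) := by
    simp [dotProduct, Finset.sum_sub_distrib, Finset.sum_div]
  rw [this, Real.exp_sum, ← Finset.prod_mul_distrib]
  refine Finset.prod_congr rfl fun i _ => ?_
  simp only [gaussianPDFReal, mul_assoc, ← Real.exp_add]
  congr 2
  simp
  ring

lemma gv_shift (n : ℕ) (f : (Fin n → ℝ) → ℝ) (c : Fin n → ℝ) :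
    ∫ w, f (w + c) ∂(gaussianVec n 1) =
      ∫ w, Real.exp (w ⬝ᵥ c - c ⬝ᵥ c / 2) * f w ∂(gaussianVec n 1) := by
  rw [gv_integral, gv_integral, ← integral_add_right_eq_self _ (-c)]
  refine integral_congr_ae (Filter.Eventually.of_forall fun w => ?_)
  simp only [neg_add_cancel_right]
  rw [← mul_assoc]
  congr 1
  exact gv_dens_shift n w c

lemma gv_mgf (n : ℕ) (c : Fin n → ℝ) :
    ∫ w, Real.exp (w ⬝ᵥ c) ∂(gaussianVec n 1) = Real.exp (c ⬝ᵥ c / 2) := by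
  have h := gv_shift n (fun _ => 1) c
  simp only [mul_one, integral_const, probReal_univ, smul_eq_mul, Real.exp_sub,
    integral_div] at h
  field_simp at h
  exact h.symm

lemma gv_mgf_int (n : ℕ) (c : Fin n → ℝ) :
    Integrable (fun w => Real.exp (w ⬝ᵥ c)) (gaussianVec n 1) := by
  apply Integrable.of_integral_ne_zero
  rw [gv_mgf]; positivity

lemma gv_lin_int (n : ℕ) (c : Fin n → ℝ) :
    Integrable (fun w => w ⬝ᵥ c) (gaussianVec n 1) := by
  refine Integrable.mono' ((gv_mgf_int n c).add (gv_mgf_int n (-c))) ?_ ?_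
  · have : Measurable (fun w : Fin n → ℝ => w ⬝ᵥ c) := by unfold dotProduct; fun_prop
    exact this.aestronglyMeasurable
  · refine Filter.Eventually.of_forall fun w => ?_
    simp only [Pi.add_apply, dotProduct_neg, Real.norm_eq_abs]
    have h1 := Real.add_one_le_exp (w ⬝ᵥ c)
    have h2 := Real.add_one_le_exp (-(w ⬝ᵥ c))
    have h3 := Real.exp_pos (w ⬝ᵥ c)
    have h4 := Real.exp_pos (-(w ⬝ᵥ c))
    rw [abs_le]; constructor <;> linarith

lemma gv_lin (n : ℕ) (c : Fin n → ℝ) : ∫ w, w ⬝ᵥ c ∂(gaussianVec n 1) = 0 := by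
  have hm : (gaussianVec n 1).map (fun w => -w) = gaussianVec n 1 := by
    rw [gv_eq]
    have := Measure.pi_map_pi (μ := fun _ : Fin n => gaussianReal 0 1) (f := fun _ x => -x)
      (fun i => measurable_neg.aemeasurable)
    simp only [gaussianReal_map_neg, neg_zero] at this
    exact this
  have h : ∫ w, w ⬝ᵥ c ∂(gaussianVec n 1) = ∫ w, (-w) ⬝ᵥ c ∂(gaussianVec n 1) := by
    conv_lhs => rw [← hm]
    rw [integral_map (by fun_prop)]
    have : Measurable (fun w : Fin n → ℝ => w ⬝ᵥ c) := by unfold dotProduct; fun_prop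
    exact this.aestronglyMeasurable
  simp only [neg_dotProduct, integral_neg] at h
  linarith

lemma gv_integrable_iff (n : ℕ) (f : (Fin n → ℝ) → ℝ) :
    Integrable f (gaussianVec n 1) ↔
      Integrable (fun w => (∏ i, gaussianPDFReal 0 1 (w i)) * f w) := by
  rw [gv_density, integrable_withDensity_iff_integrable_smul']
  · refine integrable_congr (Filter.Eventually.of_forall fun w => ?_)
    simp only [smul_eq_mul]
    rw [ENNReal.toReal_ofReal]
    exact Finset.prod_nonneg fun i _ => gaussianPDFReal_nonneg _ _ _
  · have := measurable_gaussianPDFReal 0 1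
    fun_prop
  · simp

lemma gv_shift_integrable (n : ℕ) (f : (Fin n → ℝ) → ℝ) (c : Fin n → ℝ)
    (hf : Integrable (fun w => f (w + c)) (gaussianVec n 1)) :
    Integrable (fun w => Real.exp (w ⬝ᵥ c - c ⬝ᵥ c / 2) * f w) (gaussianVec n 1) := by
  rw [gv_integrable_iff] at hf ⊢
  have h := hf.comp_add_right (-c)
  refine h.congr (Filter.Eventually.of_forall fun w => ?_)
  simp only [neg_add_cancel_right]
  rw [← mul_assoc]
  congr 1
  exact gv_dens_shift n w c

/-- weights -/
noncomputable def sE {n L : ℕ} (x : Fin L → Fin n → ℝ) (k l : Fin L) (t : ℝ) (w : Fin n → ℝ) : ℝ :=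
  Real.exp (t * (w ⬝ᵥ (x l - x k)) - t ^ 2 * ((x l - x k) ⬝ᵥ (x l - x k)) / 2)

noncomputable def sS {n L : ℕ} (x : Fin L → Fin n → ℝ) (k : Fin L) (t : ℝ) (w : Fin n → ℝ) : ℝ :=
  ∑ l, sE x k l t w

/-- average of g under the weights -/
noncomputable def sAv {n L : ℕ} (x : Fin L → Fin n → ℝ) (k : Fin L) (t : ℝ) (w : Fin n → ℝ)
    (g : Fin L → ℝ) : ℝ :=
  (∑ l, sE x k l t w * g l) / sS x k t w

section
variable {n L : ℕ} (x : Fin L → Fin n → ℝ)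

lemma sE_pos (k l : Fin L) (t : ℝ) (w : Fin n → ℝ) : 0 < sE x k l t w := Real.exp_pos _

lemma sS_ge (k : Fin L) (t : ℝ) (w : Fin n → ℝ) : 1 ≤ sS x k t w := by
  have : sE x k k t w = 1 := by simp [sE]
  rw [← this]
  exact Finset.single_le_sum (f := fun l => sE x k l t w)
    (fun l _ => (sE_pos x k l t w).le) (Finset.mem_univ k)

lemma sAv_le (k : Fin L) (t : ℝ) (w : Fin n → ℝ) (g : Fin L → ℝ) (c : ℝ) (h : ∀ l, g l ≤ c) :
    sAv x k t w g ≤ c := by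
  have hS := sS_ge x k t w
  unfold sAv
  rw [div_le_iff₀ (by linarith), sS, Finset.mul_sum]
  refine Finset.sum_le_sum fun l _ => ?_
  rw [mul_comm c]
  exact mul_le_mul_of_nonneg_left (h l) (sE_pos x k l t w).le

lemma sAv_abs_le (k : Fin L) (t : ℝ) (w : Fin n → ℝ) (g : Fin L → ℝ) :
    |sAv x k t w g| ≤ ∑ l, |g l| := by
  have hS := sS_ge x k t w
  have h : ∀ l, |g l| ≤ ∑ l, |g l| := fun l =>
    Finset.single_le_sum (f := fun l => |g l|) (fun l _ => abs_nonneg _) (Finset.mem_univ l)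
  rw [abs_le']
  refine ⟨sAv_le x k t w g _ fun l => (le_abs_self _).trans (h l), ?_⟩
  have : -sAv x k t w g = sAv x k t w (fun l => - g l) := by
    simp [sAv, neg_div]
  rw [this]
  exact sAv_le x k t w _ _ fun l => (neg_le_abs _).trans (h l)

lemma meas_dot (c : Fin n → ℝ) : Measurable (fun w : Fin n → ℝ => w ⬝ᵥ c) := by
  unfold dotProduct; fun_prop

lemma sE_meas (k l : Fin L) (t : ℝ) : Measurable (sE x k l t) := by
  have := meas_dot (x l - x k)
  unfold sE; fun_prop

lemma sS_meas (k : Fin L) (t : ℝ) : Measurable (sS x k t) := by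
  have := fun l => sE_meas x k l t
  unfold sS; fun_prop

lemma sAv_meas (k : Fin L) (t : ℝ) (g : Fin L → (Fin n → ℝ) → ℝ) (hg : ∀ l, Measurable (g l)) :
    Measurable (fun w => sAv x k t w (fun l => g l w)) := by
  have := fun l => sE_meas x k l t
  have := sS_meas x k t
  unfold sAv; fun_prop

lemma sAv_int (k : Fin L) (t : ℝ) (g : Fin L → (Fin n → ℝ) → ℝ) (hg : ∀ l, Measurable (g l))
    (hi : ∀ l, Integrable (g l) (gaussianVec n 1)) :
    Integrable (fun w => sAv x k t w (fun l => g l w)) (gaussianVec n 1) := by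
  refine Integrable.mono' (g := fun w => ∑ l, |g l w|)
    (integrable_finsetSum _ fun l _ => (hi l).abs) 
    (sAv_meas x k t g hg).aestronglyMeasurable
    (Filter.Eventually.of_forall fun w => sAv_abs_le x k t w _)

lemma sE_int (k l : Fin L) (t : ℝ) : Integrable (sE x k l t) (gaussianVec n 1) := by
  have h := (gv_mgf_int n (t • (x l - x k))).mul_const
    (Real.exp (-(t ^ 2 * ((x l - x k) ⬝ᵥ (x l - x k)) / 2)))
  refine h.congr (Filter.Eventually.of_forall fun w => ?_)
  simp only [sE, ← Real.exp_add, dotProduct_smul, smul_eq_mul]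
  congr 1

lemma sF_int (k : Fin L) (t : ℝ) :
    Integrable (fun w => Real.log (sS x k t w)) (gaussianVec n 1) := by
  refine Integrable.mono' (g := sS x k t) ?_ ?_ ?_
  · unfold sS
    exact integrable_finsetSum _ fun l _ => sE_int x k l t
  · exact (Real.measurable_log.comp (sS_meas x k t)).aestronglyMeasurable
  · refine Filter.Eventually.of_forall fun w => ?_
    have hS := sS_ge x k t w
    rw [Real.norm_eq_abs, abs_of_nonneg (Real.log_nonneg hS)]
    have := Real.log_le_sub_one_of_pos (show 0 < sS x k t w by linarith)
    linarith

lemma sF_hasDeriv (k : Fin L) (t : ℝ) (w : Fin n → ℝ) :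
    HasDerivAt (fun t => Real.log (sS x k t w))
      (sAv x k t w (fun l => w ⬝ᵥ (x l - x k) - t * ((x l - x k) ⬝ᵥ (x l - x k)))) t := by
  have hS := sS_ge x k t w
  have h1 : HasDerivAt (fun t => sS x k t w)
      (∑ l, sE x k l t w * (w ⬝ᵥ (x l - x k) - t * ((x l - x k) ⬝ᵥ (x l - x k)))) t := by
    unfold sS sE
    refine HasDerivAt.fun_sum fun l _ => ?_
    apply HasDerivAt.exp
    have h2 := ((hasDerivAt_id t).mul_const (w ⬝ᵥ (x l - x k))).sub
      ((((hasDerivAt_id t).pow 2).mul_const ((x l - x k) ⬝ᵥ (x l - x k))).div_const 2)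
    refine h2.congr_deriv ?_
    simp; ring
  exact h1.log (by linarith)

lemma sD_hasDeriv (k : Fin L) (t : ℝ) :
    HasDerivAt (fun t => ∫ w, Real.log (sS x k t w) ∂(gaussianVec n 1))
      (∫ w, sAv x k t w (fun l => w ⬝ᵥ (x l - x k) - t * ((x l - x k) ⬝ᵥ (x l - x k)))
        ∂(gaussianVec n 1)) t := by
  refine (hasDerivAt_integral_of_dominated_loc_of_deriv_le
    (F := fun t w => Real.log (sS x k t w))
    (F' := fun t w => sAv x k t w (fun l => w ⬝ᵥ (x l - x k) - t * ((x l - x k) ⬝ᵥ (x l - x k))))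
    (bound := fun w => ∑ l, (|w ⬝ᵥ (x l - x k)| + (|t| + 1) * ((x l - x k) ⬝ᵥ (x l - x k))))
    (Metric.ball_mem_nhds t one_pos) ?_ (sF_int x k t) ?_ ?_ ?_ ?_).2
  · exact Filter.Eventually.of_forall fun s => (sF_int x k s).aestronglyMeasurable
  · refine (sAv_meas x k t (fun l w => w ⬝ᵥ (x l - x k) - t * ((x l - x k) ⬝ᵥ (x l - x k)))
      fun l => ?_).aestronglyMeasurable
    have := meas_dot (x l - x k)
    fun_prop
  · refine Filter.Eventually.of_forall fun w s hs => ?_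
    refine (sAv_abs_le x k s w _).trans (Finset.sum_le_sum fun l _ => ?_)
    have hB : 0 ≤ (x l - x k) ⬝ᵥ (x l - x k) := 
      Finset.sum_nonneg fun i _ => mul_self_nonneg _
    refine (abs_sub _ _).trans ?_
    rw [abs_mul, abs_of_nonneg hB]
    have : |s| ≤ |t| + 1 := by
      rw [Metric.mem_ball, Real.dist_eq] at hs
      have := abs_sub_abs_le_abs_sub s t
      linarith
    gcongr
  · exact integrable_finsetSum _ fun l _ => ((gv_lin_int n _).abs.add (integrable_const _))
  · exact Filter.Eventually.of_forall fun w s _ => sF_hasDeriv x k s w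

lemma sE_shift (k l : Fin L) (t : ℝ) (w : Fin n → ℝ) :
    sE x k l t w = Real.exp (t * ((w + t • x k) ⬝ᵥ x l) - t ^ 2 * (x l ⬝ᵥ x l) / 2) /
      Real.exp (t * ((w + t • x k) ⬝ᵥ x k) - t ^ 2 * (x k ⬝ᵥ x k) / 2) := by
  rw [sE, ← Real.exp_sub]
  congr 1
  simp only [dotProduct_sub, sub_dotProduct, add_dotProduct, smul_dotProduct, smul_eq_mul]
  rw [dotProduct_comm (x l) (x k)]
  ring

lemma antisym (t : ℝ) :
    ∑ k, ∫ w, sAv x k t w (fun l => 2 * (w ⬝ᵥ (x l - x k)) - t * ((x l - x k) ⬝ᵥ (x l - x k)))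
        ∂(gaussianVec n 1) = 0 := by
  set e : Fin L → (Fin n → ℝ) → ℝ := fun l y =>
    Real.exp (t * (y ⬝ᵥ x l) - t ^ 2 * (x l ⬝ᵥ x l) / 2) with he
  set u : Fin L → (Fin n → ℝ) → ℝ := fun l y => 2 * (y ⬝ᵥ x l) - t * (x l ⬝ᵥ x l) with hu
  set G : Fin L → (Fin n → ℝ) → ℝ := fun k y =>
    (∑ l, e l y * (u l y - u k y)) / (∑ l, e l y) with hG
  have hGE : ∀ k w, sAv x k t w
      (fun l => 2 * (w ⬝ᵥ (x l - x k)) - t * ((x l - x k) ⬝ᵥ (x l - x k))) =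
      G k (w + t • x k) := by
    intro k w
    have hek : e k (w + t • x k) ≠ 0 := (Real.exp_pos _).ne'
    have h1 : ∀ l, sE x k l t w = e l (w + t • x k) / e k (w + t • x k) := fun l =>
      sE_shift x k l t w
    have h2 : ∀ l, 2 * (w ⬝ᵥ (x l - x k)) - t * ((x l - x k) ⬝ᵥ (x l - x k)) =
        u l (w + t • x k) - u k (w + t • x k) := by
      intro l
      simp only [hu, dotProduct_sub, sub_dotProduct, add_dotProduct, smul_dotProduct, smul_eq_mul]
      rw [dotProduct_comm (x l) (x k)]
      ring
    simp only [sAv, sS, h1, h2, hG, div_mul_eq_mul_div, ← Finset.sum_div]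
    rw [div_div_div_cancel_right₀ hek]
  have hint : ∀ k, Integrable (fun w => G k (w + t • x k)) (gaussianVec n 1) := by
    intro k
    simp only [← hGE]
    apply sAv_int x k t
      (fun l w => 2 * (w ⬝ᵥ (x l - x k)) - t * ((x l - x k) ⬝ᵥ (x l - x k)))
    · intro l
      have := meas_dot (x l - x k)
      fun_prop
    · intro l
      exact ((gv_lin_int n _).const_mul 2).sub (integrable_const _)
  have hek : ∀ k y, Real.exp (y ⬝ᵥ (t • x k) - (t • x k) ⬝ᵥ (t • x k) / 2) = e k y := by
    intro k y
    simp only [he, dotProduct_smul, smul_dotProduct, smul_eq_mul]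
    congr 1; ring
  have hi2 := fun k => gv_shift_integrable n _ _ (hint k)
  simp only [hGE, gv_shift n (G _)]
  rw [← integral_finsetSum _ fun k _ => hi2 k]
  rw [← integral_zero (Fin n → ℝ) ℝ (μ := gaussianVec n 1)]
  refine integral_congr_ae (Filter.Eventually.of_forall fun y => ?_)
  simp only [hek, hG, mul_div_assoc', ← Finset.sum_div]
  have : ∑ k, e k y * ∑ l, e l y * (u l y - u k y) = 0 := by
    have h1 : ∑ k, e k y * ∑ l, e l y * (u l y - u k y) =
        ∑ k, ∑ l, (e k y * (e l y * u l y) - e l y * (e k y * u k y)) := by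
      refine Finset.sum_congr rfl fun k _ => ?_
      rw [Finset.mul_sum]
      refine Finset.sum_congr rfl fun l _ => by ring
    rw [h1]
    simp only [Finset.sum_sub_distrib]
    rw [Finset.sum_comm, sub_self]
  rw [this, zero_div]

/-- the sup norm of the process -/
noncomputable def sM (w : Fin n → ℝ) : ℝ := ‖fun l => w ⬝ᵥ x l‖

lemma sM_int : Integrable (sM x) (gaussianVec n 1) := by
  refine Integrable.mono' (g := fun w => ∑ l, |w ⬝ᵥ x l|)
    (integrable_finsetSum _ fun l _ => (gv_lin_int n _).abs) ?_ ?_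
  · have := fun l => meas_dot (x l)
    have h : Measurable (sM x) := by unfold sM; fun_prop
    exact h.aestronglyMeasurable
  · refine Filter.Eventually.of_forall fun w => ?_
    rw [sM, norm_norm]
    exact (pi_norm_le_iff_of_nonneg (Finset.sum_nonneg fun l _ => abs_nonneg _)).2 fun l =>
      Finset.single_le_sum (f := fun l => |w ⬝ᵥ x l|) (fun l _ => abs_nonneg _) (Finset.mem_univ l)

lemma sD_deriv_ge (t : ℝ) :
    -(L * ∫ w, sM x w ∂(gaussianVec n 1)) ≤
    ∑ k, ∫ w, sAv x k t w (fun l => w ⬝ᵥ (x l - x k) - t * ((x l - x k) ⬝ᵥ (x l - x k)))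
        ∂(gaussianVec n 1) := by
  have h0 := antisym x t
  have hm : ∀ k l, Measurable fun w : Fin n → ℝ =>
      2 * (w ⬝ᵥ (x l - x k)) - t * ((x l - x k) ⬝ᵥ (x l - x k)) := by
    intro k l
    have := meas_dot (x l - x k)
    fun_prop
  have hi : ∀ k l, Integrable (fun w : Fin n → ℝ =>
      2 * (w ⬝ᵥ (x l - x k)) - t * ((x l - x k) ⬝ᵥ (x l - x k))) (gaussianVec n 1) := by
    intro k l
    exact ((gv_lin_int n _).const_mul 2).sub (integrable_const _)
  have key : ∀ k, ∫ w, sAv x k t w (fun l => w ⬝ᵥ (x l - x k) - t * ((x l - x k) ⬝ᵥ (x l - x k)))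
        ∂(gaussianVec n 1) =
      (∫ w, sAv x k t w (fun l => 2 * (w ⬝ᵥ (x l - x k)) - t * ((x l - x k) ⬝ᵥ (x l - x k)))
        ∂(gaussianVec n 1)) - ∫ w, sAv x k t w (fun l => w ⬝ᵥ x l) ∂(gaussianVec n 1) := by
    intro k
    have h1 := sAv_int x k t _ (hm k) (hi k)
    have h2 := sAv_int x k t (fun l w => w ⬝ᵥ x l) (fun l => meas_dot _) (fun l => gv_lin_int n _)
    rw [← integral_sub h1 h2, ← add_zero (∫ w, _ - _ ∂_), ← gv_lin n (x k),
      ← integral_add (by exact h1.sub h2) (gv_lin_int n _)]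
    refine integral_congr_ae (Filter.Eventually.of_forall fun w => ?_)
    have hS : sS x k t w ≠ 0 := by
      have := sS_ge x k t w
      linarith
    simp only [sAv]
    rw [← sub_div, div_add' _ _ _ hS, sS, Finset.mul_sum, ← Finset.sum_sub_distrib,
      ← Finset.sum_add_distrib]
    congr 1
    refine Finset.sum_congr rfl fun l _ => ?_
    rw [dotProduct_sub w]
    ring
  have hle : ∀ k, ∫ w, sAv x k t w (fun l => w ⬝ᵥ x l) ∂(gaussianVec n 1) ≤
      ∫ w, sM x w ∂(gaussianVec n 1) := by
    intro k
    refine integral_mono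
      (sAv_int x k t (fun l w => w ⬝ᵥ x l) (fun l => meas_dot _) (fun l => gv_lin_int n _))
      (sM_int x) fun w => ?_
    exact sAv_le x k t w _ _ fun l => (le_abs_self _).trans (norm_le_pi_norm (fun l => w ⬝ᵥ x l) l)
  simp only [key, Finset.sum_sub_distrib, h0, zero_sub]
  have := Finset.sum_le_sum fun k (_ : k ∈ Finset.univ) => hle k
  simp at this
  simpa using this

lemma sD_lower (t : ℝ) (ht : 0 ≤ t) :
    L * Real.log L - t * (L * ∫ w, sM x w ∂(gaussianVec n 1)) ≤
      ∑ k, ∫ w, Real.log (sS x k t w) ∂(gaussianVec n 1) := by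
  set c := L * ∫ w, sM x w ∂(gaussianVec n 1) with hc
  have hd : ∀ t, HasDerivAt (fun t => (∑ k, ∫ w, Real.log (sS x k t w) ∂(gaussianVec n 1)) + t * c)
      ((∑ k, ∫ w, sAv x k t w (fun l => w ⬝ᵥ (x l - x k) - t * ((x l - x k) ⬝ᵥ (x l - x k)))
        ∂(gaussianVec n 1)) + 1 * c) t := fun t =>
    (HasDerivAt.fun_sum fun k _ => sD_hasDeriv x k t).add ((hasDerivAt_id t).mul_const c)
  have hmono := monotone_of_deriv_nonneg (fun t => (hd t).differentiableAt) (fun t => by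
    rw [(hd t).deriv]
    have := sD_deriv_ge x t
    linarith)
  have h := hmono ht
  have h0 : ∀ k w, sS x k 0 w = L := by
    intro k w
    simp [sS, sE]
  simp only [h0] at h
  simp at h
  linarith

lemma sD_upper (hL : 1 ≤ L) (t d : ℝ)
    (hB : ∀ k l, l ≠ k → d ≤ (x l - x k) ⬝ᵥ (x l - x k))
    (ht : t ^ 2 * d = 8 * Real.log L) (k : Fin L) :
    ∫ w, Real.log (sS x k t w) ∂(gaussianVec n 1) ≤ 2 * Real.log 2 := by
  have hLp : (0 : ℝ) < L := by exact_mod_cast hL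
  set h : Fin L → (Fin n → ℝ) → ℝ := fun l w => 
    Real.exp (w ⬝ᵥ ((t / 2) • (x l - x k))) *
      Real.exp (-(t ^ 2 * ((x l - x k) ⬝ᵥ (x l - x k)) / 4)) with hh
  have hsq : ∀ l w, sE x k l t w = h l w ^ 2 := by
    intro l w
    simp only [hh, sE, ← Real.exp_add, ← Real.exp_nat_mul, dotProduct_smul, smul_eq_mul]
    congr 1; push_cast; ring
  have hpos : ∀ l w, 0 < h l w := fun l w => by positivity
  have hint : ∀ l, Integrable (h l) (gaussianVec n 1) := fun l => (gv_mgf_int n _).mul_const _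
  have hval : ∀ l, ∫ w, h l w ∂(gaussianVec n 1) =
      Real.exp (-(t ^ 2 * ((x l - x k) ⬝ᵥ (x l - x k)) / 8)) := by
    intro l
    simp only [hh]
    rw [integral_mul_const, gv_mgf, ← Real.exp_add]
    congr 1
    simp only [dotProduct_smul, smul_dotProduct, smul_eq_mul]; ring
  have hle : ∀ l, l ≠ k → ∫ w, h l w ∂(gaussianVec n 1) ≤ 1 / L := by
    intro l hl
    rw [hval, one_div, ← Real.exp_log (inv_pos.2 hLp), Real.log_inv]
    apply Real.exp_le_exp.2
    have := mul_le_mul_of_nonneg_left (hB k l hl) (sq_nonneg t)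
    linarith
  have hsum : ∑ l, ∫ w, h l w ∂(gaussianVec n 1) ≤ 2 := by
    rw [← Finset.add_sum_erase _ _ (Finset.mem_univ k)]
    have h1 : ∫ w, h k w ∂(gaussianVec n 1) = 1 := by rw [hval]; simp
    have h2 : ∑ l ∈ Finset.univ.erase k, ∫ w, h l w ∂(gaussianVec n 1) ≤ 1 := by
      calc _ ≤ ∑ l ∈ Finset.univ.erase k, 1 / (L : ℝ) :=
            Finset.sum_le_sum fun l hl => hle l (Finset.ne_of_mem_erase hl)
        _ ≤ ∑ l : Fin L, 1 / (L : ℝ) := Finset.sum_le_sum_of_subset_of_nonneg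
            (Finset.erase_subset _ _) fun _ _ _ => by positivity
        _ = 1 := by simp; field_simp
    linarith
  have hpt : ∀ w, Real.log (sS x k t w) ≤ 2 * (Real.log 2 + ((∑ l, h l w) / 2 - 1)) := by
    intro w
    have hS := sS_ge x k t w
    have hsp : 0 < ∑ l, h l w := Finset.sum_pos (fun l _ => hpos l w) ⟨k, Finset.mem_univ k⟩
    have h1 : sS x k t w ≤ (∑ l, h l w) ^ 2 := by
      simp only [sS, hsq]
      exact Finset.sum_sq_le_sq_sum_of_nonneg fun l _ => (hpos l w).le
    have h2 := Real.log_le_log (by linarith) h1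
    rw [Real.log_pow] at h2
    have h3 := Real.log_le_sub_one_of_pos (half_pos hsp)
    rw [Real.log_div hsp.ne' two_ne_zero] at h3
    push_cast at h2
    linarith
  have his : Integrable (fun w => ∑ l, h l w) (gaussianVec n 1) :=
    integrable_finsetSum _ fun l _ => hint l
  calc _ ≤ ∫ w, 2 * (Real.log 2 + ((∑ l, h l w) / 2 - 1)) ∂(gaussianVec n 1) := by
        refine integral_mono (sF_int x k t) ?_ hpt
        exact ((integrable_const _).add ((his.div_const 2).sub (integrable_const _))).const_mul 2
    _ = 2 * (Real.log 2 + ((∑ l, ∫ w, h l w ∂(gaussianVec n 1)) / 2 - 1)) := by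
        rw [integral_const_mul, integral_add (integrable_const _)
          (by exact (his.div_const 2).sub (integrable_const _)),
          integral_sub (his.div_const 2) (integrable_const _), integral_div,
          integral_finsetSum _ fun l _ => hint l]
        simp
    _ ≤ _ := by linarith

lemma sudakov (hL : 20 ≤ L) (d : ℝ)
    (hB : ∀ k l, l ≠ k → d ≤ (x l - x k) ⬝ᵥ (x l - x k)) :
    (1 / 2) * (1 - 1 / Real.exp 1) * Real.sqrt (Real.log L / 4 * d) ≤
      ∫ w, sM x w ∂(gaussianVec n 1) := by
  have hMn : 0 ≤ ∫ w, sM x w ∂(gaussianVec n 1) := integral_nonneg fun w => norm_nonneg _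
  have hL' : (20 : ℝ) ≤ L := by exact_mod_cast hL
  have hlog : 4 * Real.log 2 ≤ Real.log L := by
    have : 4 * Real.log 2 = Real.log (2 ^ 4) := by rw [Real.log_pow]; norm_num
    rw [this]
    exact Real.log_le_log (by norm_num) (by linarith)
  have hl2 : 0 < Real.log 2 := Real.log_pos (by norm_num)
  set ℓ := Real.log L with hℓ
  have hℓ0 : 0 < ℓ := by linarith
  rcases le_or_gt d 0 with hd | hd
  · rw [Real.sqrt_eq_zero_of_nonpos (by nlinarith)]
    simpa using hMn
  · set t := Real.sqrt (8 * ℓ / d) with ht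
    have htp : 0 < t := Real.sqrt_pos.2 (by positivity)
    have ht2 : t ^ 2 = 8 * ℓ / d := Real.sq_sqrt (by positivity)
    have h1 := sD_lower x t htp.le
    have h2 : ∑ k, ∫ w, Real.log (sS x k t w) ∂(gaussianVec n 1) ≤ L * (2 * Real.log 2) := by
      have := Finset.sum_le_sum fun k (_ : k ∈ Finset.univ) =>
        sD_upper x (by omega) t d hB (by rw [ht2, ← hℓ]; field_simp) k
      simpa using this
    set M := ∫ w, sM x w ∂(gaussianVec n 1) with hM
    have h3 : ℓ - t * M ≤ 2 * Real.log 2 := by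
      have : (L : ℝ) * (ℓ - t * M) ≤ L * (2 * Real.log 2) := by linarith
      exact le_of_mul_le_mul_left this (by linarith)
    have h4 : ℓ / 2 ≤ t * M := by linarith
    set r := Real.sqrt (ℓ / 4 * d) with hr
    have hr0 : 0 ≤ r := Real.sqrt_nonneg _
    have htr : t * r = Real.sqrt 2 * ℓ := by
      rw [ht, hr, ← Real.sqrt_mul (by positivity)]
      rw [show 8 * ℓ / d * (ℓ / 4 * d) = 2 * ℓ ^ 2 by field_simp; norm_num]
      rw [Real.sqrt_mul (by norm_num), Real.sqrt_sq hℓ0.le]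
    have hs2 : Real.sqrt 2 ≤ 1.5 := by
      rw [Real.sqrt_le_left (by norm_num)]; norm_num
    have he : 1 - 1 / Real.exp 1 ≤ 2 / 3 := by
      have h3 := Real.exp_one_lt_d9
      have : 1 / 3 ≤ 1 / Real.exp 1 := one_div_le_one_div_of_le (Real.exp_pos _) (by linarith)
      linarith
    refine le_of_mul_le_mul_left ?_ htp
    calc t * (1 / 2 * (1 - 1 / Real.exp 1) * r)
        = (1 / 2 * (1 - 1 / Real.exp 1)) * (t * r) := by ring
      _ ≤ (1 / 2 * (2 / 3)) * (1.5 * ℓ) := by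
          rw [htr]
          gcongr
      _ = ℓ / 2 := by ring
      _ ≤ t * M := h4

end

/-- Lower bound on the expected maximum, eq. (lead). -/
theorem expected_max_lower_bound
    (n L : ℕ) (hn : 1 ≤ n) (hL : 20 ≤ L) (X : Fin n → Fin L → ℝ) :
    (∫ w, lqNorm ⊤ (fun j => (1 / (n : ℝ)) * ∑ i, X i j * w i) ∂(gaussianVec n 1))
      ≥ (1 / 2) * (1 - 1 / Real.exp 1) *
        Real.sqrt ((Real.log L / (4 * (n : ℝ) ^ 2)) *
          ((Finset.univ.filter (fun pr : Fin L × Fin L => pr.1 ≠ pr.2)).inf'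
            ⟨(⟨0, by omega⟩, ⟨1, by omega⟩), by
              simp [Finset.mem_filter, Fin.ext_iff]⟩
            (fun pr => ∑ i, (X i pr.1 - X i pr.2) ^ 2))) := by
  have hn' : (0 : ℝ) < n := by exact_mod_cast hn
  set I := ((Finset.univ.filter (fun pr : Fin L × Fin L => pr.1 ≠ pr.2)).inf'
            ⟨(⟨0, by omega⟩, ⟨1, by omega⟩), by
              simp [Finset.mem_filter, Fin.ext_iff]⟩
            (fun pr => ∑ i, (X i pr.1 - X i pr.2) ^ 2)) with hI
  have h := sudakov (fun l i => X i l) hL I (by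
    intro k l hkl
    have := Finset.inf'_le (s := Finset.univ.filter (fun pr : Fin L × Fin L => pr.1 ≠ pr.2))
      (fun pr => ∑ i, (X i pr.1 - X i pr.2) ^ 2) (b := (l, k)) (by simpa using hkl)
    refine this.trans (le_of_eq ?_)
    simp [dotProduct, sq])
  have h1 : ∀ w : Fin n → ℝ, lqNorm ⊤ (fun j => (1 / (n : ℝ)) * ∑ i, X i j * w i) =
      (1 / (n : ℝ)) * sM (fun l i => X i l) w := by
    intro w
    rw [lqNorm_top_eq, sM]
    have : (fun j => (1 / (n : ℝ)) * ∑ i, X i j * w i) =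
        (1 / (n : ℝ)) • (fun l => w ⬝ᵥ (fun i => X i l)) := by
      ext j
      simp [dotProduct, mul_comm]
    rw [this, norm_smul, Real.norm_eq_abs, abs_of_pos (by positivity)]
  simp only [h1]
  rw [integral_const_mul]
  have h2 : Real.sqrt (Real.log L / (4 * (n : ℝ) ^ 2) * I) =
      1 / n * Real.sqrt (Real.log L / 4 * I) := by
    rw [show Real.log L / (4 * (n : ℝ) ^ 2) * I = (1 / (n : ℝ)) ^ 2 * (Real.log L / 4 * I) by
      field_simp, Real.sqrt_mul (sq_nonneg _), Real.sqrt_sq (by positivity)]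
  rw [h2]
  have h3 := mul_le_mul_of_nonneg_left h (show 0 ≤ 1 / (n : ℝ) by positivity)
  refine ge_iff_le.2 (le_trans (le_of_eq ?_) h3)
  ring
end

section
/- (Lemma A.2) Suppose U = (U₁,…,U_n) consists of independent random variables, all supported on [a, b], and f : ℝⁿ → ℝ is separately convex and ℒ-Lipschitz with respect to the Euclidean norm. Then for all λ ∈ ℝ, E[exp(λ(f(U) − E[f(U)]))] ≤ exp(λ²(b−a)²ℒ²/2); consequently, for all t ≥ 0, P{f(U) − E[f(U)] ≤ −t} ≤ exp(−t²/(2ℒ²(b−a)²)) and P{f(U) − E[f(U)] ≥ t} ≤ exp(−t²/(2ℒ²(b−a)²)). -/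
open MeasureTheory ProbabilityTheory
open scoped ENNReal NNReal

/-- A function on `ℝⁿ` is separately convex if it is convex in each coordinate
when all the other coordinates are held fixed. -/
def SeparatelyConvex {n : ℕ} (f : (Fin n → ℝ) → ℝ) : Prop :=
  ∀ (j : Fin n) (u : Fin n → ℝ),
    ConvexOn ℝ Set.univ (fun x : ℝ => f (Function.update u j x))


/-- pointwise bound -/
lemma bdc_point {D : ℝ} (hD : 0 < D) {g G : ℝ → ℝ}
    (hg : ∀ x y p : ℝ, 0 ≤ p → p ≤ 1 → g ((1 - p) * x + p * y) ≤ (1 - p) * g x + p * g y)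
    (hG : ∀ x y : ℝ, g y - (x - y) ^ 2 / (2 * D ^ 2) ≤ G x)
    {x y p : ℝ} (hp0 : 0 ≤ p) (hp1 : p ≤ 1) (hxy : |x - y| ≤ D) :
    g x ≤ (1 - p) * G x + p * G y + p ^ 2 / 2 := by
  have h1 := hG x (x + p * (x - y))
  have h2 := hG y (y + p * (x - y))
  have h3 := hg (x + p * (x - y)) (y + p * (x - y)) p hp0 hp1
  have e : (1 - p) * (x + p * (x - y)) + p * (y + p * (x - y)) = x := by ring
  rw [e] at h3
  have hsq : (x - y) ^ 2 ≤ D ^ 2 := by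
    rw [← sq_abs]; exact pow_le_pow_left₀ (abs_nonneg _) hxy 2
  have h4 : (p * (x - y)) ^ 2 / (2 * D ^ 2) ≤ p ^ 2 / 2 := by
    rw [div_le_div_iff₀ (by positivity) (by norm_num)]
    nlinarith [mul_le_mul_of_nonneg_left hsq (sq_nonneg p)]
  have e1 : (x - (x + p * (x - y))) ^ 2 = (p * (x - y)) ^ 2 := by ring
  have e2 : (y - (y + p * (x - y))) ^ 2 = (p * (x - y)) ^ 2 := by ring
  rw [e1] at h1
  rw [e2] at h2
  nlinarith [mul_le_mul_of_nonneg_left h1 (sub_nonneg.2 hp1), mul_le_mul_of_nonneg_left h2 hp0]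

lemma bdc_exp_neg {w : ℝ} (hw : 0 ≤ w) : Real.exp (-w) ≤ 1 - w + w ^ 2 / 2 := by
  have h := Real.quadratic_le_exp_of_nonneg hw
  have h2 : Real.exp (-w) * Real.exp w = 1 := by rw [← Real.exp_add]; simp
  have h3 := Real.exp_pos (-w)
  have hq : 0 < 1 - w + w ^ 2 / 2 := by nlinarith [sq_nonneg (w - 1)]
  have : Real.exp (-w) * (1 + w + w ^ 2 / 2) ≤ 1 := by
    exact (mul_le_mul_of_nonneg_left h h3.le).trans h2.le
  have h5 : 1 ≤ (1 - w + w ^ 2 / 2) * (1 + w + w ^ 2 / 2) := by nlinarith [pow_nonneg hw 4]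
  by_contra hc
  push Not at hc
  nlinarith [mul_lt_mul_of_pos_right hc (by positivity : 0 < 1 + w + w ^ 2 / 2)]

lemma bdc_exp_theta {w : ℝ} (hw : 0 ≤ w) : Real.exp (w - w ^ 2 / 2) ≤ 1 + w := by
  have h : w - w ^ 2 / 2 ≤ Real.log (1 + w) := by
    have := Real.le_log_one_add_of_nonneg hw
    refine le_trans ?_ this
    rw [le_div_iff₀ (by positivity)]
    nlinarith [pow_nonneg hw 3]
  calc _ ≤ Real.exp (Real.log (1 + w)) := Real.exp_le_exp.2 h
    _ = _ := Real.exp_log (by positivity)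

lemma bdc_case {D : ℝ} (hD : 0 < D) {g G : ℝ → ℝ}
    (hg : ∀ x y p : ℝ, 0 ≤ p → p ≤ 1 → g ((1 - p) * x + p * y) ≤ (1 - p) * g x + p * g y)
    (hG : ∀ x y : ℝ, g y - (x - y) ^ 2 / (2 * D ^ 2) ≤ G x)
    {x y : ℝ} (hxy : |x - y| ≤ D) (hm : G y ≤ G x) :
    ∃ w, 0 ≤ w ∧ w ≤ G x - G y ∧ g x ≤ G y + (w - w ^ 2 / 2) := by
  by_cases h1 : G x - G y ≤ 1
  · refine ⟨G x - G y, by linarith, le_rfl, ?_⟩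
    have := bdc_point hD hg hG (p := G x - G y) (by linarith) h1 hxy
    nlinarith
  · refine ⟨1, by norm_num, by linarith, ?_⟩
    have := bdc_point hD hg hG (p := 1) (by norm_num) (by norm_num) hxy
    nlinarith

section
variable {n : ℕ} {a b : ℝ}

lemma bdc_restrict (μ : Fin n → Measure ℝ) [∀ i, IsProbabilityMeasure (μ i)]
    (hs : ∀ i, (μ i).restrict (Set.Icc a b) = μ i) :
    (Measure.pi μ).restrict (Set.pi Set.univ (fun _ => Set.Icc a b)) = Measure.pi μ := by
  rw [Measure.restrict_pi_pi]
  congr 1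
  funext i
  exact hs i

lemma bdc_int (μ : Fin n → Measure ℝ) [∀ i, IsProbabilityMeasure (μ i)]
    (hs : ∀ i, (μ i).restrict (Set.Icc a b) = μ i) {φ : (Fin n → ℝ) → ℝ} (h : Continuous φ) :
    Integrable φ (Measure.pi μ) := by
  rw [← bdc_restrict μ hs]
  exact h.continuousOn.integrableOn_compact (isCompact_univ_pi fun _ => isCompact_Icc)

lemma bdc_int1 (μ : Measure ℝ) [IsProbabilityMeasure μ]
    (hs : μ.restrict (Set.Icc a b) = μ) {φ : ℝ → ℝ} (h : Continuous φ) :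
    Integrable φ μ := by
  rw [← hs]
  exact h.continuousOn.integrableOn_compact isCompact_Icc

lemma bdc_cont (μ : Fin n → Measure ℝ) [∀ i, IsProbabilityMeasure (μ i)]
    (hs : ∀ i, (μ i).restrict (Set.Icc a b) = μ i) {φ : (Fin (n + 1) → ℝ) → ℝ}
    (h : Continuous φ) :
    Continuous (fun x : ℝ => ∫ u, φ (Fin.cons x u) ∂(Measure.pi μ)) := by
  rw [← bdc_restrict μ hs]
  refine continuous_parametric_integral_of_continuous
    (f := fun (x : ℝ) (u : Fin n → ℝ) => φ (Fin.cons x u)) ?_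
    (isCompact_univ_pi fun _ => isCompact_Icc)
  refine h.comp ?_
  exact Continuous.finCons continuous_fst continuous_snd

lemma bdc_fubini (μ : Fin (n + 1) → Measure ℝ) [∀ i, IsProbabilityMeasure (μ i)]
    (hs : ∀ i, (μ i).restrict (Set.Icc a b) = μ i) {φ : (Fin (n + 1) → ℝ) → ℝ}
    (h : Continuous φ) :
    ∫ v, φ v ∂(Measure.pi μ) =
      ∫ x, ∫ u, φ (Fin.cons x u) ∂(Measure.pi fun i : Fin n => μ i.succ) ∂(μ 0) := by
  have mp := measurePreserving_piFinSuccAbove μ 0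
  have mp' := mp.symm
  have hi := bdc_int μ hs h
  rw [← mp'.integral_comp' (g := φ), integral_prod]
  · simp only [MeasurableEquiv.piFinSuccAbove_symm_apply, Fin.succAbove_zero]
    refine integral_congr_ae (Filter.Eventually.of_forall fun x => ?_)
    refine integral_congr_ae (Filter.Eventually.of_forall fun u => ?_)
    exact congrArg φ (Fin.insertNth_zero' x u)
  · exact (mp'.integrable_comp_emb (MeasurableEquiv.measurableEmbedding _)).2 hi

lemma bdc_oneA (hab : a < b) (μ : Measure ℝ) [IsProbabilityMeasure μ]
    (hs : μ.restrict (Set.Icc a b) = μ) {g G : ℝ → ℝ} (cg : Continuous g) (cG : Continuous G)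
    (hg : ∀ x y p : ℝ, 0 ≤ p → p ≤ 1 → g ((1 - p) * x + p * y) ≤ (1 - p) * g x + p * g y)
    (hG : ∀ x y : ℝ, g y - (x - y) ^ 2 / (2 * (b - a) ^ 2) ≤ G x) :
    ∫ x, Real.exp (-G x) ∂μ ≤ Real.exp (-∫ x, g x ∂μ) := by
  obtain ⟨y, hy, hmin⟩ := isCompact_Icc.exists_isMinOn (Set.nonempty_Icc.2 hab.le) cG.continuousOn
  have ae : ∀ᵐ x ∂μ, x ∈ Set.Icc a b := by
    rw [← hs]; exact ae_restrict_mem measurableSet_Icc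
  have key : ∫ x, Real.exp (-G x) * Real.exp (G y) ∂μ ≤ ∫ x, (G y + 1 - g x) ∂μ := by
    refine integral_mono_ae (bdc_int1 μ hs (by fun_prop)) (bdc_int1 μ hs (by fun_prop)) ?_
    filter_upwards [ae] with x hx
    have hxy : |x - y| ≤ b - a := by
      rw [abs_le]; constructor <;> linarith [hx.1, hx.2, hy.1, hy.2]
    obtain ⟨w, w0, w1, w2⟩ := bdc_case (sub_pos.2 hab) hg hG hxy (hmin hx)
    rw [← Real.exp_add]
    have h1 : Real.exp (-G x + G y) ≤ Real.exp (-w) := Real.exp_le_exp.2 (by linarith)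
    have := bdc_exp_neg w0
    linarith
  rw [integral_mul_const, integral_sub (integrable_const _) (bdc_int1 μ hs cg)] at key
  simp only [integral_const, probReal_univ, one_smul] at key
  have h2 := Real.add_one_le_exp (G y - ∫ x, g x ∂μ)
  have h3 : (∫ x, Real.exp (-G x) ∂μ) * Real.exp (G y) ≤
      Real.exp (-∫ x, g x ∂μ) * Real.exp (G y) := by
    rw [← Real.exp_add]
    have e : -(∫ x, g x ∂μ) + G y = G y - ∫ x, g x ∂μ := by ring
    rw [e]; linarith
  exact le_of_mul_le_mul_right h3 (Real.exp_pos _)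

lemma bdc_oneB (hab : a < b) (μ : Measure ℝ) [IsProbabilityMeasure μ]
    (hs : μ.restrict (Set.Icc a b) = μ) {g G : ℝ → ℝ} (cg : Continuous g) (cG : Continuous G)
    (hg : ∀ x y p : ℝ, 0 ≤ p → p ≤ 1 → g ((1 - p) * x + p * y) ≤ (1 - p) * g x + p * g y)
    (hG : ∀ x y : ℝ, g y - (x - y) ^ 2 / (2 * (b - a) ^ 2) ≤ G x) :
    ∫ x, Real.exp (g x) ∂μ ≤ Real.exp (∫ x, G x ∂μ) := by
  obtain ⟨y, hy, hmin⟩ := isCompact_Icc.exists_isMinOn (Set.nonempty_Icc.2 hab.le) cG.continuousOn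
  have ae : ∀ᵐ x ∂μ, x ∈ Set.Icc a b := by
    rw [← hs]; exact ae_restrict_mem measurableSet_Icc
  have key : ∫ x, Real.exp (g x) * Real.exp (-G y) ∂μ ≤ ∫ x, (G x - (G y - 1)) ∂μ := by
    refine integral_mono_ae (bdc_int1 μ hs (by fun_prop)) (bdc_int1 μ hs (by fun_prop)) ?_
    filter_upwards [ae] with x hx
    have hxy : |x - y| ≤ b - a := by
      rw [abs_le]; constructor <;> linarith [hx.1, hx.2, hy.1, hy.2]
    obtain ⟨w, w0, w1, w2⟩ := bdc_case (sub_pos.2 hab) hg hG hxy (hmin hx)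
    rw [← Real.exp_add]
    have h1 : Real.exp (g x + -G y) ≤ Real.exp (w - w ^ 2 / 2) := Real.exp_le_exp.2 (by linarith)
    have := bdc_exp_theta w0
    linarith
  rw [integral_mul_const, integral_sub (bdc_int1 μ hs cG) (integrable_const _)] at key
  simp only [integral_const, probReal_univ, one_smul] at key
  have h2 := Real.add_one_le_exp ((∫ x, G x ∂μ) - G y)
  have h3 : (∫ x, Real.exp (g x) ∂μ) * Real.exp (-G y) ≤
      Real.exp (∫ x, G x ∂μ) * Real.exp (-G y) := by
    rw [← Real.exp_add, ← sub_eq_add_neg]; linarith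
  exact le_of_mul_le_mul_right h3 (Real.exp_pos _)

lemma bdc_sep_tail {f : (Fin (n + 1) → ℝ) → ℝ} (hf : SeparatelyConvex f) (x : ℝ) :
    SeparatelyConvex (fun u : Fin n → ℝ => f (Fin.cons x u)) := by
  intro j u
  have := hf j.succ (Fin.cons x u)
  simpa only [Fin.cons_update] using this

lemma bdc_sep_head {f : (Fin (n + 1) → ℝ) → ℝ} (hf : SeparatelyConvex f) (u : Fin n → ℝ)
    (x y p : ℝ) (hp0 : 0 ≤ p) (hp1 : p ≤ 1) :
    f (Fin.cons ((1 - p) * x + p * y) u) ≤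
      (1 - p) * f (Fin.cons x u) + p * f (Fin.cons y u) := by
  have := (hf 0 (Fin.cons 0 u)).2 (Set.mem_univ x) (Set.mem_univ y) (sub_nonneg.2 hp1) hp0
    (by ring)
  simpa only [Fin.update_cons_zero, smul_eq_mul] using this

lemma bdc_cost {D : ℝ} {f F : (Fin (n + 1) → ℝ) → ℝ}
    (hF : ∀ x y, f y - (∑ i, (x i - y i) ^ 2) / (2 * D ^ 2) ≤ F x) (x0 y0 : ℝ)
    (x y : Fin n → ℝ) :
    f (Fin.cons y0 y) - (∑ i, (x i - y i) ^ 2) / (2 * D ^ 2) ≤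
      F (Fin.cons x0 x) + (x0 - y0) ^ 2 / (2 * D ^ 2) := by
  have := hF (Fin.cons x0 x) (Fin.cons y0 y)
  rw [Fin.sum_univ_succ] at this
  simp only [Fin.cons_zero, Fin.cons_succ, add_div] at this
  linarith

end

lemma bdc_A {a b : ℝ} (hab : a < b) : ∀ (n : ℕ) (μ : Fin n → Measure ℝ)
    [∀ i, IsProbabilityMeasure (μ i)] (_ : ∀ i, (μ i).restrict (Set.Icc a b) = μ i)
    (f F : (Fin n → ℝ) → ℝ) (_ : Continuous f) (_ : Continuous F) (_ : SeparatelyConvex f)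
    (_ : ∀ x y, f y - (∑ i, (x i - y i) ^ 2) / (2 * (b - a) ^ 2) ≤ F x),
    ∫ u, Real.exp (-F u) ∂(Measure.pi μ) ≤ Real.exp (-∫ u, f u ∂(Measure.pi μ)) := by
  intro n
  induction n with
  | zero =>
    intro μ _ _ f F _ _ _ hF
    rw [Measure.pi_of_empty μ default]
    simp only [integral_dirac]
    have := hF default default
    simp only [Finset.univ_eq_empty, Finset.sum_empty, zero_div, sub_zero] at this
    exact Real.exp_le_exp.2 (by linarith)
  | succ n ih =>
    intro μ _ hs f F cf cF hf hF
    have hs' : ∀ i : Fin n, (μ i.succ).restrict (Set.Icc a b) = μ i.succ := fun i => hs _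
    have ccons : ∀ x : ℝ, Continuous (fun u : Fin n → ℝ => (Fin.cons x u : Fin (n + 1) → ℝ)) :=
      fun x => Continuous.finCons continuous_const continuous_id
    set ν := Measure.pi fun i : Fin n => μ i.succ with hν
    have ceF : Continuous (fun v => Real.exp (-F v)) := by fun_prop
    rw [bdc_fubini μ hs cf, bdc_fubini μ hs ceF]
    have cI := bdc_cont (fun i : Fin n => μ i.succ) hs' ceF
    have pos : ∀ x : ℝ, 0 < ∫ u, Real.exp (-F (Fin.cons x u)) ∂ν := fun x =>
      integral_exp_pos (bdc_int _ hs' (ceF.comp (ccons x)))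
    have h1 := bdc_oneA hab (μ 0) (hs 0)
      (g := fun x => ∫ u, f (Fin.cons x u) ∂ν)
      (G := fun x => -Real.log (∫ u, Real.exp (-F (Fin.cons x u)) ∂ν))
      (bdc_cont _ hs' cf) (Continuous.neg (cI.log fun x => (pos x).ne')) ?_ ?_
    · simpa only [neg_neg, Real.exp_log (pos _)] using h1
    · intro x y p hp0 hp1
      have i1 : ∀ x, Integrable (fun u => f (Fin.cons x u)) ν :=
        fun x => bdc_int _ hs' (cf.comp (ccons x))
      rw [← integral_const_mul, ← integral_const_mul,
        ← integral_add ((i1 x).const_mul _) ((i1 y).const_mul _)]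
      exact integral_mono (i1 _) (((i1 x).const_mul _).add ((i1 y).const_mul _))
        fun u => bdc_sep_head hf u x y p hp0 hp1
    · intro x y
      have h2 := ih (fun i => μ i.succ) hs' (fun u => f (Fin.cons y u))
        (fun u => F (Fin.cons x u) + (x - y) ^ 2 / (2 * (b - a) ^ 2))
        (cf.comp (ccons y)) ((cF.comp (ccons x)).add continuous_const) (bdc_sep_tail hf y)
        (fun u v => bdc_cost hF x y u v)
      simp only [neg_add, Real.exp_add] at h2
      rw [integral_mul_const, ← Real.exp_log (pos x), ← Real.exp_add, Real.exp_le_exp] at h2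
      linarith

lemma bdc_B {a b : ℝ} (hab : a < b) : ∀ (n : ℕ) (μ : Fin n → Measure ℝ)
    [∀ i, IsProbabilityMeasure (μ i)] (_ : ∀ i, (μ i).restrict (Set.Icc a b) = μ i)
    (f F : (Fin n → ℝ) → ℝ) (_ : Continuous f) (_ : Continuous F) (_ : SeparatelyConvex f)
    (_ : ∀ x y, f y - (∑ i, (x i - y i) ^ 2) / (2 * (b - a) ^ 2) ≤ F x),
    ∫ u, Real.exp (f u) ∂(Measure.pi μ) ≤ Real.exp (∫ u, F u ∂(Measure.pi μ)) := by
  intro n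
  induction n with
  | zero =>
    intro μ _ _ f F _ _ _ hF
    rw [Measure.pi_of_empty μ default]
    simp only [integral_dirac]
    have := hF default default
    simp only [Finset.univ_eq_empty, Finset.sum_empty, zero_div, sub_zero] at this
    exact Real.exp_le_exp.2 (by linarith)
  | succ n ih =>
    intro μ _ hs f F cf cF hf hF
    have hs' : ∀ i : Fin n, (μ i.succ).restrict (Set.Icc a b) = μ i.succ := fun i => hs _
    have ccons : ∀ x : ℝ, Continuous (fun u : Fin n → ℝ => (Fin.cons x u : Fin (n + 1) → ℝ)) :=
      fun x => Continuous.finCons continuous_const continuous_id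
    set ν := Measure.pi fun i : Fin n => μ i.succ with hν
    have cef : Continuous (fun v => Real.exp (f v)) := by fun_prop
    rw [bdc_fubini μ hs cF, bdc_fubini μ hs cef]
    have cI := bdc_cont (fun i : Fin n => μ i.succ) hs' cef
    have ie : ∀ x : ℝ, Integrable (fun u => Real.exp (f (Fin.cons x u))) ν :=
      fun x => bdc_int _ hs' (cef.comp (ccons x))
    have pos : ∀ x : ℝ, 0 < ∫ u, Real.exp (f (Fin.cons x u)) ∂ν := fun x =>
      integral_exp_pos (ie x)
    have h1 := bdc_oneB hab (μ 0) (hs 0)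
      (g := fun x => Real.log (∫ u, Real.exp (f (Fin.cons x u)) ∂ν))
      (G := fun x => ∫ u, F (Fin.cons x u) ∂ν)
      (cI.log fun x => (pos x).ne') (bdc_cont _ hs' cF) ?_ ?_
    · simpa only [Real.exp_log (pos _)] using h1
    · intro x y p hp0 hp1
      set A := Real.log (∫ u, Real.exp (f (Fin.cons x u)) ∂ν) with hA
      set B := Real.log (∫ u, Real.exp (f (Fin.cons y u)) ∂ν) with hB
      have eA : ∫ u, Real.exp (f (Fin.cons x u)) ∂ν = Real.exp A := (Real.exp_log (pos x)).symm
      have eB : ∫ u, Real.exp (f (Fin.cons y u)) ∂ν = Real.exp B := (Real.exp_log (pos y)).symm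
      rw [Real.log_le_iff_le_exp (pos _)]
      have h3 : ∫ u, Real.exp (f (Fin.cons ((1 - p) * x + p * y) u)) *
          Real.exp (-((1 - p) * A + p * B)) ∂ν ≤
          ∫ u, ((1 - p) * Real.exp (-A) * Real.exp (f (Fin.cons x u)) +
            p * Real.exp (-B) * Real.exp (f (Fin.cons y u))) ∂ν := by
        refine integral_mono ((ie _).mul_const _) (((ie x).const_mul _).add ((ie y).const_mul _)) ?_
        intro u
        have h4 := bdc_sep_head hf u x y p hp0 hp1
        have h5 := convexOn_exp.2 (Set.mem_univ (f (Fin.cons x u) - A))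
          (Set.mem_univ (f (Fin.cons y u) - B)) (sub_nonneg.2 hp1) hp0 (by ring)
        simp only [smul_eq_mul] at h5
        have h6 : Real.exp (f (Fin.cons ((1 - p) * x + p * y) u)) *
          Real.exp (-((1 - p) * A + p * B)) ≤
            Real.exp ((1 - p) * (f (Fin.cons x u) - A) + p * (f (Fin.cons y u) - B)) := by
          rw [← Real.exp_add]; exact Real.exp_le_exp.2 (by linarith)
        refine h6.trans (h5.trans (le_of_eq ?_))
        simp only [sub_eq_add_neg, Real.exp_add]
        ring
      rw [integral_mul_const, integral_add ((ie x).const_mul _) ((ie y).const_mul _),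
        integral_const_mul, integral_const_mul, eA, eB, mul_assoc, mul_assoc, ← Real.exp_add,
        ← Real.exp_add] at h3
      simp only [neg_add_cancel, Real.exp_zero] at h3
      rw [Real.exp_neg, ← div_eq_mul_inv, div_le_iff₀ (Real.exp_pos _)] at h3
      linarith
    · intro x y
      have iF : Integrable (fun u => F (Fin.cons x u)) ν := bdc_int _ hs' (cF.comp (ccons x))
      have h2 := ih (fun i => μ i.succ) hs' (fun u => f (Fin.cons y u))
        (fun u => F (Fin.cons x u) + (x - y) ^ 2 / (2 * (b - a) ^ 2))
        (cf.comp (ccons y)) ((cF.comp (ccons x)).add continuous_const) (bdc_sep_tail hf y)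
        (fun u v => bdc_cost hF x y u v)
      rw [integral_add iF (integrable_const _), ← Real.log_le_iff_le_exp (pos y)] at h2
      simp only [integral_const, probReal_univ, one_smul] at h2
      linarith

lemma bdc_mgf
    (n : ℕ) (a b ℒ : ℝ) (hab : a < b) (hℒ : 0 < ℒ)
    (μ : Fin n → Measure ℝ) [∀ i, IsProbabilityMeasure (μ i)]
    (hs : ∀ i, (μ i).restrict (Set.Icc a b) = μ i)
    (f : (Fin n → ℝ) → ℝ) (cf : Continuous f)
    (hconv : SeparatelyConvex f)
    (hf : ∀ z z' : Fin n → ℝ, |f z - f z'| ≤ ℒ * Real.sqrt (∑ i, (z i - z' i) ^ 2)) (lam : ℝ) :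
      (∫ u, Real.exp (lam * (f u - ∫ u', f u' ∂(Measure.pi μ))) ∂(Measure.pi μ))
        ≤ Real.exp (lam ^ 2 * (b - a) ^ 2 * ℒ ^ 2 / 2) := by
  have hD : 0 < b - a := sub_pos.2 hab
  have key : ∀ c : ℝ, 0 ≤ c → ∀ x y : Fin n → ℝ,
      c * f y - (∑ i, (x i - y i) ^ 2) / (2 * (b - a) ^ 2) ≤
        c * f x + c ^ 2 * (b - a) ^ 2 * ℒ ^ 2 / 2 := by
    intro c hc x y
    set S := ∑ i, (x i - y i) ^ 2 with hS
    have hS0 : 0 ≤ S := Finset.sum_nonneg fun i _ => sq_nonneg _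
    have h1 := hf x y
    have h2 : f y - f x ≤ ℒ * Real.sqrt S := by
      have := neg_abs_le (f x - f y); linarith
    have h3 : c * (f y - f x) ≤ c * (ℒ * Real.sqrt S) := mul_le_mul_of_nonneg_left h2 hc
    have h4 : S / (2 * (b - a) ^ 2) = (Real.sqrt S / (b - a)) ^ 2 / 2 := by
      rw [div_pow, Real.sq_sqrt hS0]; field_simp
    have h5 : c * (ℒ * Real.sqrt S) = (c * ℒ * (b - a)) * (Real.sqrt S / (b - a)) := by
      field_simp
    rw [h4]
    nlinarith [sq_nonneg (c * ℒ * (b - a) - Real.sqrt S / (b - a))]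
  have hsc : ∀ c : ℝ, 0 ≤ c → SeparatelyConvex (fun u => c * f u) := by
    intro c hc j u
    exact (hconv j u).smul hc
  have fi : Integrable f (Measure.pi μ) := bdc_int μ hs cf
  set E := ∫ u', f u' ∂(Measure.pi μ) with hE
  have e : ∀ u, Real.exp (lam * (f u - E)) = Real.exp (lam * f u) * Real.exp (-(lam * E)) := by
    intro u; rw [← Real.exp_add]; congr 1; ring
  simp only [e]
  rw [integral_mul_const, Real.exp_neg, ← div_eq_mul_inv, div_le_iff₀ (Real.exp_pos _),
    ← Real.exp_add]
  rcases le_total 0 lam with hl | hl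
  · have := bdc_B hab n μ hs (fun u => lam * f u)
      (fun u => lam * f u + lam ^ 2 * (b - a) ^ 2 * ℒ ^ 2 / 2) (by fun_prop) (by fun_prop)
      (hsc _ hl) (key _ hl)
    rw [integral_add (fi.const_mul _) (integrable_const _), integral_const_mul] at this
    simp only [integral_const, probReal_univ, one_smul] at this
    rwa [add_comm] at this
  · have := bdc_A hab n μ hs (fun u => (-lam) * f u)
      (fun u => (-lam) * f u + (-lam) ^ 2 * (b - a) ^ 2 * ℒ ^ 2 / 2) (by fun_prop) (by fun_prop)
      (hsc _ (neg_nonneg.2 hl)) (key _ (neg_nonneg.2 hl))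
    simp only [neg_add, neg_mul, neg_neg, Real.exp_add, neg_sq] at this
    rw [integral_mul_const, integral_neg, neg_neg, integral_const_mul, Real.exp_neg,
      ← div_eq_mul_inv, div_le_iff₀ (Real.exp_pos _)] at this
    rw [Real.exp_add, mul_comm]
    exact this

/-- Lemma A.2: MGF bound and two-sided tail bounds for separately
convex Lipschitz functions of independent bounded random variables. -/
theorem bounded_difference_concentration
    (n : ℕ) (hn : 1 ≤ n) (a b ℒ : ℝ) (hab : a < b) (hℒ : 0 < ℒ)
    (μ : Fin n → Measure ℝ) [∀ i, IsProbabilityMeasure (μ i)]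
    (hsupp : ∀ i, μ i (Set.Icc a b) = 1)
    (f : (Fin n → ℝ) → ℝ)
    (hconv : SeparatelyConvex f)
    (hf : ∀ z z' : Fin n → ℝ, |f z - f z'| ≤ ℒ * Real.sqrt (∑ i, (z i - z' i) ^ 2)) :
    (∀ lam : ℝ,
      (∫ u, Real.exp (lam * (f u - ∫ u', f u' ∂(Measure.pi μ))) ∂(Measure.pi μ))
        ≤ Real.exp (lam ^ 2 * (b - a) ^ 2 * ℒ ^ 2 / 2)) ∧
    (∀ t : ℝ, 0 ≤ t →
      ((Measure.pi μ) {u | f u - (∫ u', f u' ∂(Measure.pi μ)) ≤ -t}).toReal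
          ≤ Real.exp (-t ^ 2 / (2 * ℒ ^ 2 * (b - a) ^ 2)) ∧
        ((Measure.pi μ) {u | f u - (∫ u', f u' ∂(Measure.pi μ)) ≥ t}).toReal
          ≤ Real.exp (-t ^ 2 / (2 * ℒ ^ 2 * (b - a) ^ 2))) := by
  have hs : ∀ i, (μ i).restrict (Set.Icc a b) = μ i := fun i =>
    Measure.restrict_eq_self_of_ae_mem ((prob_compl_eq_zero_iff measurableSet_Icc).2 (hsupp i))
  have cf : Continuous f := by
    rw [continuous_iff_continuousAt]
    intro z
    rw [ContinuousAt, tendsto_iff_dist_tendsto_zero]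
    have hc : Continuous (fun y : Fin n → ℝ => ℒ * Real.sqrt (∑ i, (y i - z i) ^ 2)) := by
      fun_prop
    have h0 := hc.tendsto z
    simp only [sub_self, ne_eq, OfNat.ofNat_ne_zero, not_false_eq_true, zero_pow,
      Finset.sum_const_zero, Real.sqrt_zero, mul_zero] at h0
    exact squeeze_zero (fun _ => dist_nonneg) (fun y => by rw [Real.dist_eq]; exact hf y z) h0
  have hD : 0 < b - a := sub_pos.2 hab
  have mgfb := bdc_mgf n a b ℒ hab hℒ μ hs f cf hconv hf
  refine ⟨mgfb, fun t ht => ?_⟩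
  set E := ∫ u', f u' ∂(Measure.pi μ) with hE
  have hi : ∀ lam : ℝ, Integrable (fun u => Real.exp (lam * (f u - E))) (Measure.pi μ) :=
    fun lam => bdc_int μ hs (by fun_prop)
  have hl : 0 ≤ t / (ℒ ^ 2 * (b - a) ^ 2) := by positivity
  constructor
  · have h1 := measure_le_le_exp_mul_mgf (μ := Measure.pi μ) (X := fun u => f u - E) (-t)
      (neg_nonpos.2 hl) (hi _)
    refine h1.trans ((mul_le_mul_of_nonneg_left (mgfb _) (Real.exp_pos _).le).trans ?_)
    rw [← Real.exp_add, Real.exp_le_exp]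
    apply le_of_eq
    field_simp
    ring
  · have h1 := measure_ge_le_exp_mul_mgf (μ := Measure.pi μ) (X := fun u => f u - E) t
      hl (hi _)
    refine h1.trans ((mul_le_mul_of_nonneg_left (mgfb _) (Real.exp_pos _).le).trans ?_)
    rw [← Real.exp_add, Real.exp_le_exp]
    apply le_of_eq
    field_simp
    ring
end
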